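/- arXiv:math/0504539 — 4 statements merged into one kernel-verified Lean document; each statement's English description precedes it below -/
import Mathlib

section
/- Let 𝔞 be a finite-dimensional Lie algebra over a field F of prime characteristic, and let S be a simple module over the universal enveloping algebra U(𝔞). Then S is finite-dimensional over F. -/
open Submodule

/-- Span of the products of at most `d` generators. -/
def LP (F : Type*) [Field F] {A : Type*} [Ring A] [Algebra F A] {n : ℕ} (x : Fin n → A) (d : ℕ) :
    Submodule F A :=
  span F ((fun l : List (Fin n) => (l.map x).prod) '' {l | l.length ≤ d})

section
variable {F : Type*} [Field F] {A : Type*} [Ring A] [Algebra F A] {n : ℕ} (x : Fin n → A)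

lemma LP_mem (l : List (Fin n)) {d : ℕ} (h : l.length ≤ d) : (l.map x).prod ∈ LP F x d :=
  subset_span ⟨l, h, rfl⟩

lemma LP_mono {a b : ℕ} (h : a ≤ b) : LP F x a ≤ LP F x b :=
  span_mono (Set.image_mono fun _ hl => le_trans hl h)

lemma LP_mul {a b : ℕ} {u v : A} (hu : u ∈ LP F x a) (hv : v ∈ LP F x b) :
    u * v ∈ LP F x (a + b) := by
  have : LP F x a * LP F x b ≤ LP F x (a + b) := by
    unfold LP
    rw [Submodule.span_mul_span, Submodule.span_le]
    rintro _ ⟨_, ⟨l, hl, rfl⟩, _, ⟨m, hm, rfl⟩, rfl⟩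
    refine subset_span ⟨l ++ m, ?_, by simp⟩
    simp only [Set.mem_ofPred_eq, List.length_append] at *
    omega
  exact this (Submodule.mul_mem_mul hu hv)

lemma LP_x (i : Fin n) : x i ∈ LP F x 1 := by
  simpa using LP_mem (F := F) x [i] (d := 1) (by simp)

lemma LP_pow (i : Fin n) (k : ℕ) : x i ^ k ∈ LP F x k := by
  simpa using LP_mem (F := F) x (List.replicate k i) (d := k) (by simp)

lemma LP_perm (hx : ∀ i j, x i * x j - x j * x i ∈ LP F x 1) {l m : List (Fin n)}
    (h : l.Perm m) : (l.map x).prod - (m.map x).prod ∈ LP F x (l.length - 1) := by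
  induction h with
  | nil => simp
  | @cons a l m h ih =>
    rcases l with _ | ⟨b, l⟩
    · have := h.nil_eq; subst this; simp
    · simp only [List.map_cons, List.prod_cons, ← mul_sub] at ih ⊢
      refine LP_mono x ?_ (LP_mul x (LP_x x a) ih)
      simp; omega
  | swap a b l =>
    have := LP_mul x (hx b a) (LP_mem x l le_rfl)
    simp only [List.map_cons, List.prod_cons, ← mul_assoc, ← sub_mul]
    exact LP_mono x (by simp; omega) this
  | trans h1 h2 ih1 ih2 =>
    rw [h1.length_eq] at ih1 ⊢
    simpa using add_mem ih1 ih2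

/-- Main spanning step. -/
lemma LP_top (Z : Subalgebra F (Subalgebra.center F A))
    (hx : ∀ i j, x i * x j - x j * x i ∈ LP F x 1)
    (hgen : Algebra.adjoin F (Set.range x) = ⊤)
    (q : Fin n → ℕ) 
    (hz : ∀ i, ∃ z : Z, x i ^ (q i) - ((z : Subalgebra.center F A) : A) ∈ LP F x (q i - 1)) 
    (hq : ∀ i, 0 < q i) : Module.Finite Z A := by
  classical
  set D := ∑ i, (q i - 1) with hD
  set N : Submodule Z A := span Z ((fun l : List (Fin n) => (l.map x).prod) '' {l | l.length ≤ D}) with hN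
  have hLN : ∀ {u}, u ∈ LP F x D → u ∈ N := by
    intro u hu
    exact Submodule.span_subset_span F Z _ hu
  have key : ∀ l : List (Fin n), l.length ≤ D + 1 → (l.map x).prod ∈ N := by
    intro l hl
    rcases Nat.lt_or_ge D l.length with h | h
    swap
    · exact hLN (LP_mem x l h)
    have hlen : l.length = D + 1 := by omega
    obtain ⟨i, hi⟩ : ∃ i, q i ≤ l.count i := by
      by_contra! hc
      have : ∑ i, l.count i = l.length := by
        simpa using Multiset.sum_count_eq_card (s := Finset.univ) (m := (l : Multiset (Fin n))) (by simp)
      have h2 : ∑ i, l.count i ≤ D := Finset.sum_le_sum fun i _ => by have := hc i; omega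
      omega
    obtain ⟨m, hm⟩ := (List.replicate_sublist_iff.2 hi).exists_perm_append
    have hml : q i + m.length = D + 1 := by rw [← hlen, hm.length_eq]; simp
    have h1 := LP_perm (F := F) x hx hm
    obtain ⟨z, hz⟩ := hz i
    have h2 := LP_mul x hz (LP_mem x m le_rfl)
    have h3 : (m.map x).prod ∈ N := hLN (LP_mem x m (by have := hq i; omega))
    have h4 := N.smul_mem z h3
    have h5 : z • (m.map x).prod = ((z : Subalgebra.center F A) : A) * (m.map x).prod := rfl
    rw [h5] at h4
    have h1' := hLN (LP_mono x (by omega) h1)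
    have h2' := hLN (LP_mono x (by have := hq i; omega) h2)
    have := add_mem (add_mem h1' h2') h4
    simpa [sub_mul] using this
  have hxN : ∀ i, ∀ u ∈ N, x i * u ∈ N := by
    intro i u hu
    induction hu using Submodule.span_induction with
    | mem u h =>
      obtain ⟨l, hl, rfl⟩ := h
      simpa using key (i :: l) (by simpa using hl)
    | zero => simp
    | add a b _ _ ha hb => rw [mul_add]; exact add_mem ha hb
    | smul z a _ ha =>
      have : x i * z • a = z • (x i * a) := by
        change x i * (((z : Subalgebra.center F A) : A) * a) =
          ((z : Subalgebra.center F A) : A) * (x i * a)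
        rw [← mul_assoc, ← mul_assoc, Subalgebra.mem_center_iff.1 z.1.2 (x i)]
      rw [this]
      exact N.smul_mem z ha
  have hall : ∀ a : A, ∀ u ∈ N, a * u ∈ N := by
    intro a
    have ha : a ∈ Algebra.adjoin F (Set.range x) := by rw [hgen]; trivial
    induction ha using Algebra.adjoin_induction with
    | mem a h => obtain ⟨i, rfl⟩ := h; exact hxN i
    | algebraMap r =>
      intro u hu
      rw [← Algebra.smul_def, ← algebraMap_smul Z r u]
      exact N.smul_mem _ hu
    | add a b _ _ ha hb => intro u hu; rw [add_mul]; exact add_mem (ha u hu) (hb u hu)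
    | mul a b _ _ ha hb => intro u hu; rw [mul_assoc]; exact ha _ (hb u hu)
  have h1N : (1 : A) ∈ N := by simpa using key [] (by simp)
  have htop : N = ⊤ := by
    rw [eq_top_iff]; intro a _; simpa using hall a 1 h1N
  refine ⟨?_⟩
  rw [← htop, hN]
  exact Submodule.fg_span ((List.finite_length_le (Fin n) D).image _)

lemma simple_fin {S : Type*} [AddCommGroup S] [Module A S] [Module F S]
    [IsSimpleModule A S] (Z : Type*) [CommRing Z] [Algebra F Z] [Algebra.FiniteType F Z]
    [Module Z S] [IsScalarTower F Z S] [Module.Finite Z S]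
    (hcomm : ∀ (a : A) (r : Z) (t : S), a • r • t = r • a • t) : Module.Finite F S := by
  have : Nontrivial S := IsSimpleModule.nontrivial A S
  obtain ⟨s, hs⟩ := exists_ne (0 : S)
  have hfin : Module.Finite Z S := inferInstance
  set I := Module.annihilator Z S with hI
  have hI1 : I ≠ ⊤ := by
    intro h
    have : (1 : Z) ∈ I := by rw [h]; trivial
    exact hs (by simpa using Module.mem_annihilator.1 this s)
  obtain ⟨m, hm, hIm⟩ := Ideal.exists_le_maximal I hI1
  let P : Submodule A S :=
    { (m • (⊤ : Submodule Z S)).toAddSubmonoid with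
      smul_mem' := by
        intro a t ht
        change t ∈ m • (⊤ : Submodule Z S) at ht
        change a • t ∈ m • (⊤ : Submodule Z S)
        induction ht using Submodule.smul_induction_on' with
        | smul r hr t _ =>
          rw [hcomm]
          exact Submodule.smul_mem_smul hr trivial
        | add u _ v _ hu hv => rw [smul_add]; exact add_mem hu hv }
  have hP : P = ⊥ := by
    refine (eq_bot_or_eq_top P).resolve_right fun h => ?_
    have h' : (⊤ : Submodule Z S) ≤ m • ⊤ := by
      intro t _
      have : t ∈ P := by rw [h]; trivial
      exact this
    obtain ⟨r, hr1, hr2⟩ :=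
      Submodule.exists_sub_one_mem_and_smul_eq_zero_of_fg_of_le_smul m ⊤ hfin.1 h'
    have : r ∈ m := hIm (Module.mem_annihilator.2 fun t => hr2 t trivial)
    exact hm.ne_top ((Ideal.eq_top_iff_one m).2 (by have h9 := sub_mem this hr1; rwa [sub_sub_cancel] at h9))
  have htor : Module.IsTorsionBySet Z S (m : Set Z) := by
    rintro t ⟨r, hr⟩
    have : r • t ∈ P := show r • t ∈ m • (⊤ : Submodule Z S) from Submodule.smul_mem_smul hr trivial
    rw [hP] at this
    exact this
  letI : Module (Z ⧸ m) S := htor.module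
  letI : Field (Z ⧸ m) := Ideal.Quotient.field m
  have : IsScalarTower Z (Z ⧸ m) S := htor.isScalarTower
  have : IsScalarTower F (Z ⧸ m) S := ⟨fun r z s => by
    obtain ⟨z, rfl⟩ := Ideal.Quotient.mk_surjective z
    change (Ideal.Quotient.mk m (r • z)) • s = r • (Ideal.Quotient.mk m z) • s
    change (r • z) • s = r • z • s
    rw [smul_assoc]⟩
  have : Module.Finite (Z ⧸ m) S := Module.Finite.of_restrictScalars_finite Z _ _
  have : Algebra.FiniteType F (Z ⧸ m) := inferInstance
  have : Module.Finite F (Z ⧸ m) := finite_of_finite_type_of_isJacobsonRing F _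
  exact Module.Finite.trans (Z ⧸ m) S

end

lemma exists_rel {F V : Type*} [Field F] [AddCommGroup V] [Module F V] [FiniteDimensional F V]
    (f : ℕ → V) : ∃ (k : ℕ) (a : ℕ → F), f k = ∑ i ∈ Finset.range k, a i • f i := by
  let c : ℕ →o Submodule F V := ⟨fun k => span F (f '' (Finset.range k)), fun a b h =>
    span_mono (Set.image_mono (by simpa using h))⟩
  obtain ⟨k, hk⟩ := monotone_stabilizes_iff_noetherian.2 (inferInstance : IsNoetherian F V) c
  have : f k ∈ c k := by
    rw [hk (k+1) (by omega)]
    exact subset_span ⟨k, by simp, rfl⟩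
  obtain ⟨a, ha⟩ := (Submodule.mem_span_image_finset_iff_exists_fun F).1 this
  classical
  refine ⟨k, fun i => if h : i ∈ Finset.range k then a ⟨i, h⟩ else 0, ?_⟩
  rw [← ha, ← Finset.sum_coe_sort (Finset.range k)]
  refine Finset.sum_congr rfl fun i _ => ?_
  simp only [dif_pos i.2]

attribute [local instance] LieRing.ofAssociativeRing

lemma ad_pp {F : Type*} [Field F] {p : ℕ} [Fact p.Prime] [CharP F p] {A : Type*} [Ring A] [Nontrivial A]
    [Algebra F A] {L : Type*} [LieRing L] [LieAlgebra F L] (ι : L →ₗ⁅F⁆ A) (x y : L) (k : ℕ) :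
    ι x ^ p ^ k * ι y - ι y * ι x ^ p ^ k = ι (((LieAlgebra.ad F L x) ^ p ^ k) y) := by
  have : CharP (Module.End F A) p := charP_of_injective_algebraMap (algebraMap F _).injective p
  have h := sub_pow_char_pow_of_commute (p := p) (n := k) (LinearMap.commute_mulLeft_right (R := F) (ι x) (ι x))
  have h2 : ∀ m, ((LinearMap.mulLeft F (ι x) - LinearMap.mulRight F (ι x)) ^ m) (ι y)
      = ι (((LieAlgebra.ad F L x) ^ m) y) := by
    intro m
    induction m with
    | zero => simp
    | succ m ih =>
      rw [pow_succ', pow_succ', Module.End.mul_apply, ih]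
      simp [LieRing.of_associative_ring_bracket]
  rw [← h2, h]
  simp [LinearMap.pow_mulLeft, LinearMap.pow_mulRight]

lemma adjoin_iota (F : Type*) [Field F] (L : Type*) [LieRing L] [LieAlgebra F L] :
    Algebra.adjoin F (Set.range (UniversalEnvelopingAlgebra.ι F : L → UniversalEnvelopingAlgebra F L)) = ⊤ := by
  have h1 : Function.Surjective (UniversalEnvelopingAlgebra.mkAlgHom F L) := by
    intro a
    exact Quotient.inductionOn' a fun t => ⟨t, rfl⟩
  rw [← AlgHom.range_eq_top] at h1
  rw [← h1, ← Algebra.map_top, ← TensorAlgebra.adjoin_range_ι, AlgHom.map_adjoin, ← Set.range_comp]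
  rfl

theorem simple_module_finiteDimensional
    (F : Type*) [Field F] (p : ℕ) [Fact p.Prime] [CharP F p]
    (L : Type*) [LieRing L] [LieAlgebra F L] [FiniteDimensional F L]
    (S : Type*) [AddCommGroup S] [Module (UniversalEnvelopingAlgebra F L) S]
    [Module F S] [IsScalarTower F (UniversalEnvelopingAlgebra F L) S]
    [IsSimpleModule (UniversalEnvelopingAlgebra F L) S] :
    FiniteDimensional F S := by
  have : Nontrivial S := IsSimpleModule.nontrivial (UniversalEnvelopingAlgebra F L) S
  have : Nontrivial (UniversalEnvelopingAlgebra F L) := Module.nontrivial (UniversalEnvelopingAlgebra F L) S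
  let ι : L →ₗ⁅F⁆ UniversalEnvelopingAlgebra F L := UniversalEnvelopingAlgebra.ι F
  let b := Module.finBasis F L
  let x := fun i => ι (b i)
  have hιx : ∀ y, ι y ∈ span F (Set.range x) := by
    intro y
    have : y ∈ span F (Set.range b) := by rw [b.span_eq]; trivial
    have := Submodule.mem_map_of_mem (f := (ι : L →ₗ[F] UniversalEnvelopingAlgebra F L)) this
    rw [Submodule.map_span, ← Set.range_comp] at this
    exact this
  have hιL : ∀ y, ι y ∈ LP F x 1 := fun y => by
    refine (span_le.2 ?_) (hιx y)
    rintro _ ⟨i, rfl⟩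
    exact LP_x x i
  have hgen : Algebra.adjoin F (Set.range x) = ⊤ := by
    rw [eq_top_iff, ← adjoin_iota]
    refine Algebra.adjoin_le ?_
    rintro _ ⟨y, rfl⟩
    exact Algebra.span_le_adjoin F _ (hιx y)
  choose k a hk using fun i => exists_rel (F := F) (fun j => (LieAlgebra.ad F L (b i)) ^ p ^ j)
  have hc : ∀ i, x i ^ p ^ k i - ∑ j ∈ Finset.range (k i), a i j • x i ^ p ^ j
      ∈ Subalgebra.center F (UniversalEnvelopingAlgebra F L) := by
    intro i
    set w := x i ^ p ^ k i - ∑ j ∈ Finset.range (k i), a i j • x i ^ p ^ j with hw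
    have h1 : ∀ y, w * ι y - ι y * w = 0 := by
      intro y
      have : w * ι y - ι y * w = (x i ^ p ^ k i * ι y - ι y * x i ^ p ^ k i)
          - ∑ j ∈ Finset.range (k i), a i j • (x i ^ p ^ j * ι y - ι y * x i ^ p ^ j) := by
        rw [hw, sub_mul, mul_sub, Finset.sum_mul, Finset.mul_sum]
        simp only [smul_sub, Finset.sum_sub_distrib, smul_mul_assoc, mul_smul_comm]
        abel
      rw [this]
      simp only [x, ad_pp]
      rw [hk i]
      simp
    rw [Subalgebra.mem_center_iff]
    intro u
    have hu : u ∈ Algebra.adjoin F (Set.range (UniversalEnvelopingAlgebra.ι F : L → UniversalEnvelopingAlgebra F L)) := by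
      rw [adjoin_iota]; trivial
    induction hu using Algebra.adjoin_induction with
    | mem u h => obtain ⟨y, rfl⟩ := h; exact (sub_eq_zero.1 (h1 y)).symm
    | algebraMap r => exact Algebra.commutes r w
    | add a b _ _ ha hb => rw [add_mul, mul_add, ha, hb]
    | mul a b _ _ ha hb => rw [mul_assoc, hb, ← mul_assoc, ha, mul_assoc]
  let z : Fin (Module.finrank F L) → Subalgebra.center F (UniversalEnvelopingAlgebra F L) :=
    fun i => ⟨_, hc i⟩
  let Z := Algebra.adjoin F (Set.range z)
  have hp : 0 < p := (Fact.out : p.Prime).pos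
  have hp1 : 1 < p := (Fact.out : p.Prime).one_lt
  have : Algebra.FiniteType F Z :=
    (Subalgebra.fg_iff_finiteType _).1 (Subalgebra.fg_def.2 ⟨_, Set.finite_range z, rfl⟩)
  have : Module.Finite Z (UniversalEnvelopingAlgebra F L) := by
    refine LP_top x Z ?_ hgen (fun i => p ^ k i) ?_ (fun i => pow_pos hp _)
    · intro i j
      have : x i * x j - x j * x i = ι ⁅b i, b j⁆ := by
        rw [LieHom.map_lie, LieRing.of_associative_ring_bracket]
      rw [this]; exact hιL _
    · intro i
      refine ⟨⟨z i, Algebra.subset_adjoin ⟨i, rfl⟩⟩, ?_⟩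
      have : x i ^ p ^ k i - (z i : UniversalEnvelopingAlgebra F L)
          = ∑ j ∈ Finset.range (k i), a i j • x i ^ p ^ j := by
        simp [z]
      rw [this]
      refine sum_mem fun j hj => smul_mem _ _ (LP_mono x ?_ (LP_pow x i _))
      have := Nat.pow_lt_pow_right hp1 (Finset.mem_range.1 hj)
      omega
  obtain ⟨s, hs⟩ := exists_ne (0 : S)
  have : IsScalarTower F Z S := ⟨fun r z s => by
    change (r • ((z : Subalgebra.center F (UniversalEnvelopingAlgebra F L)) :
      UniversalEnvelopingAlgebra F L)) • s = r • ((z : Subalgebra.center F (UniversalEnvelopingAlgebra F L)) :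
      UniversalEnvelopingAlgebra F L) • s
    rw [smul_assoc]⟩
  have : Module.Finite Z S := by
    let f : UniversalEnvelopingAlgebra F L →ₗ[Z] S :=
      { toFun := fun u => u • s
        map_add' := fun u v => add_smul u v s
        map_smul' := fun z u => mul_smul ((z : Subalgebra.center F (UniversalEnvelopingAlgebra F L)) :
          UniversalEnvelopingAlgebra F L) u s }
    refine Module.Finite.of_surjective f ?_
    exact IsSimpleModule.toSpanSingleton_surjective (UniversalEnvelopingAlgebra F L) hs
  refine simple_fin (A := UniversalEnvelopingAlgebra F L) Z fun a r t => ?_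
  change a • ((r : Subalgebra.center F (UniversalEnvelopingAlgebra F L)) :
    UniversalEnvelopingAlgebra F L) • t = ((r : Subalgebra.center F (UniversalEnvelopingAlgebra F L)) :
    UniversalEnvelopingAlgebra F L) • a • t
  rw [← mul_smul, ← mul_smul, Subalgebra.mem_center_iff.1 r.1.2 a]
end

section
/- Let 𝔞 be a finite-dimensional Lie algebra over a field of prime characteristic. Then the injective hull of every locally finite U(𝔞)-module is locally finite. -/
/-- A submodule `N ≤ M` is essential if it meets every nonzero submodule nontrivially. -/
def Submodule.IsEssentialSub {R M : Type*} [Ring R] [AddCommGroup M] [Module R M]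
    (N : Submodule R M) : Prop :=
  ∀ P : Submodule R M, P ≠ ⊥ → N ⊓ P ≠ ⊥

/-- A module over an `F`-algebra `R` is locally finite if every cyclic `R`-submodule is
finite-dimensional over `F`. -/
def IsLocallyFinite (F : Type*) {R M : Type*} [Field F] [Ring R] [Algebra F R]
    [AddCommGroup M] [Module R M] [Module F M] [IsScalarTower F R M] : Prop :=
  ∀ m : M, Module.Finite F ((Submodule.span R {m}).restrictScalars F)

namespace InjHull

/-- If `A ⧸ J` is finite-dimensional and `J ^ n` kills a finite `A`-module, it is
finite-dimensional. -/
lemma finite_of_pow_smul {F A : Type} [Field F] [CommRing A] [Algebra F A] [IsNoetherianRing A]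
    (J : Ideal A) (hJ : Module.Finite F (A ⧸ J)) (n : ℕ) :
    ∀ (N : Type) [AddCommGroup N] [Module A N] [Module F N] [IsScalarTower F A N]
      [Module.Finite A N], (J ^ n • (⊤ : Submodule A N) = ⊥) → Module.Finite F N := by
  induction n with
  | zero =>
    intro N _ _ _ _ _ h
    have : Subsingleton N := by
      rw [pow_zero, Ideal.one_eq_top, Submodule.top_smul] at h
      exact (Submodule.subsingleton_iff A).1 (subsingleton_of_bot_eq_top h.symm)
    infer_instance
  | succ n ih =>
    intro N _ _ _ _ _ h
    let K : Submodule A N := J • ⊤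
    have hK : Module.Finite F K := by
      apply ih K
      have hmap : (J ^ n • (⊤ : Submodule A K)).map K.subtype = ⊥ := by
        rw [Submodule.map_smul'', Submodule.map_top, Submodule.range_subtype]
        rw [← h, pow_succ, Submodule.mul_smul]
      rw [eq_bot_iff]
      intro x hx
      have : K.subtype x ∈ (⊥ : Submodule A N) := hmap ▸ Submodule.mem_map_of_mem hx
      simpa using this
    have hQ : Module.Finite F (N ⧸ K) := by
      have : Module.Finite (A ⧸ J) (N ⧸ K) := Module.Finite.of_restrictScalars_finite A _ _
      have : IsScalarTower F (A ⧸ J) (N ⧸ K) := by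
        constructor
        intro a b c
        obtain ⟨b, rfl⟩ := Ideal.Quotient.mk_surjective b
        have h1 : a • (Ideal.Quotient.mk J b) = Ideal.Quotient.mk J (a • b) := rfl
        rw [h1]
        induction c using Submodule.Quotient.induction_on with
        | H c =>
          change Submodule.Quotient.mk ((a • b) • c) = Submodule.Quotient.mk (a • (b • c))
          rw [smul_assoc]
      exact Module.Finite.trans (A ⧸ J) _
    have : Module.Finite F (K.restrictScalars F) := hK
    have : Module.Finite F (N ⧸ K.restrictScalars F) := hQ
    exact Module.Finite.of_submodule_quotient (K.restrictScalars F)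

lemma finite_annihilator {F A V : Type} [Field F] [CommRing A] [Algebra F A]
    [AddCommGroup V] [Module A V] [Module F V] [IsScalarTower F A V] [Module.Finite F V] :
    Module.Finite F (A ⧸ Module.annihilator A V) := by
  let g : A →ₐ[F] Module.End F V := Algebra.lsmul F F V
  have hg : ∀ a ∈ Module.annihilator A V, g a = 0 := by
    intro a ha
    exact LinearMap.ext fun m => Module.mem_annihilator.1 ha m
  let e := Ideal.Quotient.liftₐ (Module.annihilator A V) g hg
  refine Module.Finite.of_injective e.toLinearMap ?_
  refine (injective_iff_map_eq_zero e).2 ?_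
  intro a ha
  obtain ⟨a, rfl⟩ := Ideal.Quotient.mk_surjective a
  refine Ideal.Quotient.eq_zero_iff_mem.2 (Module.mem_annihilator.2 fun m => ?_)
  exact LinearMap.congr_fun (f := g a) (g := 0) ha m

lemma core {F A U I : Type} [Field F] [CommRing A] [Algebra F A] [IsNoetherianRing A]
    [Ring U] [Algebra F U] [Algebra A U] [IsScalarTower F A U] [Module.Finite A U]
    [AddCommGroup I] [Module U I] [Module F I] [IsScalarTower F U I]
    [Module A I] [IsScalarTower A U I] [IsScalarTower F A I]
    (E : Submodule U I) (hess : E.IsEssentialSub)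
    (hE : ∀ m ∈ E, Module.Finite F ((Submodule.span U {m}).restrictScalars F)) :
    IsLocallyFinite F (R := U) (M := I) := by
  intro x
  set N : Submodule U I := Submodule.span U {x} with hN
  have fgN : Module.Finite A N := by
    have : Module.Finite U N := Module.Finite.iff_fg.2 (Submodule.fg_span_singleton x)
    exact Module.Finite.trans U N
  have noeth : IsNoetherian A N := inferInstance
  -- the intersection
  let M' : Submodule U N := E.comap N.subtype
  have hM'fg : M'.FG := by
    have : (M'.restrictScalars A).FG := IsNoetherian.noetherian _
    exact Submodule.FG.of_restrictScalars A this
  have hM'fin : Module.Finite F (M'.restrictScalars F) := by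
    have key : ∀ P : Submodule U N, P.FG → P ≤ M' → Module.Finite F (P.restrictScalars F) := by
      intro P hP
      induction P, hP using Submodule.fg_induction with
      | singleton y =>
        intro hy
        have hy' : (y : I) ∈ E := hy (Submodule.mem_span_singleton_self y)
        have h1 := hE _ hy'
        let g : (Submodule.span U {y}).restrictScalars F →ₗ[F]
            (Submodule.span U {(y : I)}).restrictScalars F :=
          { toFun := fun w => ⟨((w : N) : I), by
              obtain ⟨u, hu⟩ := Submodule.mem_span_singleton.1 w.2
              refine Submodule.mem_span_singleton.2 ⟨u, ?_⟩
              rw [← hu]; rfl⟩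
            map_add' := fun _ _ => rfl
            map_smul' := fun _ _ => rfl }
        refine Module.Finite.of_injective g ?_
        intro a b hab
        have hab' : (g a : I) = (g b : I) := by rw [hab]
        exact Subtype.ext (Subtype.ext hab')
      | sup P Q _ _ hP hQ =>
        intro hPQ
        have h1 := hP (le_sup_left.trans hPQ)
        have h2 := hQ (le_sup_right.trans hPQ)
        rw [Submodule.restrictScalars_sup] 
        exact Submodule.finite_sup _ _
    exact key M' hM'fg le_rfl
  let MA : Submodule A N := M'.restrictScalars A
  let J : Ideal A := Module.annihilator A MA
  have hJ : Module.Finite F (A ⧸ J) := by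
    have : Module.Finite F MA := hM'fin
    exact finite_annihilator
  obtain ⟨k, hk⟩ := Ideal.exists_pow_inf_eq_pow_smul J MA
  have hk1 := hk (k+1) (Nat.le_succ k)
  have hzero : J ^ (k+1) • (⊤ : Submodule A N) ⊓ MA = ⊥ := by
    rw [hk1, Nat.add_sub_cancel_left, pow_one, eq_bot_iff]
    refine Submodule.smul_le.2 ?_
    intro j hj m hm
    have := (Module.mem_annihilator.1 hj) ⟨m, hm.2⟩
    exact congrArg Subtype.val this
  have comm : ∀ (a : A) (u : U) (n : N), u • a • n = a • u • n := by
    intro a u n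
    rw [← algebraMap_smul U a n, ← algebraMap_smul U a (u • n), smul_smul, smul_smul,
      Algebra.commutes]
  let P : Submodule U N :=
    { (J ^ (k+1) • (⊤ : Submodule A N)) with
      smul_mem' := by
        intro u y hy
        change y ∈ J ^ (k+1) • (⊤ : Submodule A N) at hy
        change u • y ∈ J ^ (k+1) • (⊤ : Submodule A N)
        induction hy using Submodule.smul_induction_on' with
        | smul r hr n hn => rw [comm]; exact Submodule.smul_mem_smul hr trivial
        | add y _ z _ h1 h2 => rw [smul_add]; exact add_mem h1 h2 }
  have hP : P.map N.subtype = ⊥ := by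
    by_contra hne
    apply hess _ hne
    rw [eq_bot_iff]
    rintro _ ⟨hyE, y, hyP, rfl⟩
    have : y ∈ J ^ (k+1) • (⊤ : Submodule A N) ⊓ MA := ⟨hyP, hyE⟩
    rw [hzero] at this
    have : y = 0 := this
    simp [this]
  have hfin : Module.Finite F N := by
    refine finite_of_pow_smul J hJ (k+1) N ?_
    rw [eq_bot_iff]
    intro y hy
    have : N.subtype y ∈ (⊥ : Submodule U I) := hP ▸ Submodule.mem_map_of_mem (p := P) hy
    simpa using this
  exact hfin

end InjHull

namespace InjHull

section alg
variable {F L U : Type} [Field F] [LieRing L] [LieAlgebra F L] [Ring U] [Algebra F U]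

lemma ad_pow (e : L →ₗ[F] U) (he : ∀ x y, e ⁅x, y⁆ = e x * e y - e y * e x) (x y : L) (n : ℕ) :
    ((LinearMap.mulLeft F (e x) - LinearMap.mulRight F (e x)) ^ n) (e y)
      = e (((LieAlgebra.ad F L x) ^ n) y) := by
  induction n with
  | zero => simp
  | succ n ih =>
    rw [pow_succ', pow_succ', Module.End.mul_apply, Module.End.mul_apply, ih, LieAlgebra.ad_apply,
      he]
    simp

lemma ad_pow_char [Nontrivial U] (p : ℕ) [Fact p.Prime] [CharP F p]
    (e : L →ₗ[F] U) (he : ∀ x y, e ⁅x, y⁆ = e x * e y - e y * e x) (x y : L) (k : ℕ) :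
    e x ^ (p ^ k) * e y - e y * e x ^ (p ^ k) = e (((LieAlgebra.ad F L x) ^ (p ^ k)) y) := by
  have : CharP (Module.End F U) p := charP_of_injective_algebraMap
    (algebraMap F (Module.End F U)).injective p
  rw [← ad_pow e he, sub_pow_char_pow_of_commute _ _ (LinearMap.commute_mulLeft_right _ _),
    LinearMap.pow_mulLeft, LinearMap.pow_mulRight]
  simp

lemma exists_central [Nontrivial U] [FiniteDimensional F L] (p : ℕ) [Fact p.Prime] [CharP F p]
    (e : L →ₗ[F] U) (he : ∀ x y, e ⁅x, y⁆ = e x * e y - e y * e x)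
    (hgen : Algebra.adjoin F (Set.range e) = ⊤) (x : L) :
    ∃ (q : ℕ) (z : Subalgebra.center F U), 0 < q ∧
      e x ^ q - z ∈ Submodule.span F ((fun k : ℕ => e x ^ k) '' Set.Iio q) := by
  let v : ℕ → Module.End F L := fun k => (LieAlgebra.ad F L x) ^ (p ^ k)
  let S : ℕ →o Submodule F (Module.End F L) :=
    ⟨fun n => Submodule.span F (v '' (Finset.range n : Set ℕ)), fun a b hab =>
      Submodule.span_mono (Set.image_mono (by
        simpa using hab))⟩
  obtain ⟨n, hn⟩ := monotone_stabilizes_iff_noetherian.2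
    (inferInstance : IsNoetherian F (Module.End F L)) S
  have hv : v n ∈ S n := by
    rw [hn (n+1) (Nat.le_succ n)]
    exact Submodule.subset_span ⟨n, by simp, rfl⟩
  obtain ⟨c, hc⟩ := Submodule.mem_span_image_finset_iff_exists_fun' F |>.1 hv
  let r : U := ∑ k ∈ Finset.range n, c k • e x ^ (p ^ k)
  have hcen : e x ^ (p ^ n) - r ∈ Subalgebra.center F U := by
    have h1 : ∀ y, e y * (e x ^ (p ^ n) - r) = (e x ^ (p ^ n) - r) * e y := by
      intro y
      have h2 : r * e y - e y * r = e (v n y) := by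
        rw [← hc]
        simp only [r, Finset.sum_mul, Finset.mul_sum, ← Finset.sum_sub_distrib,
          LinearMap.sum_apply, map_sum, LinearMap.smul_apply, map_smul, smul_mul_assoc,
          mul_smul_comm, ← smul_sub, v, ad_pow_char p e he]
      have h3 := ad_pow_char p e he x y n
      rw [← sub_eq_zero]
      have : (e x ^ p ^ n * e y - e y * e x ^ p ^ n) - (r * e y - e y * r) = 0 := by
        rw [h3, h2, sub_self]
      rw [mul_sub, sub_mul, ← neg_eq_zero, ← this]
      abel
    rw [Subalgebra.mem_center_iff]
    intro b
    have hb : b ∈ Algebra.adjoin F (Set.range e) := by rw [hgen]; trivial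
    have : Algebra.adjoin F (Set.range e) ≤ Subalgebra.centralizer F {e x ^ (p ^ n) - r} := by
      refine Algebra.adjoin_le ?_
      rintro _ ⟨y, rfl⟩
      rw [SetLike.mem_coe, Subalgebra.mem_centralizer_iff]
      rintro _ rfl
      exact (h1 y).symm
    exact ((Subalgebra.mem_centralizer_iff F).1 (this hb) _ rfl).symm
  refine ⟨p ^ n, ⟨_, hcen⟩, Nat.pow_pos (Fact.out : p.Prime).pos, ?_⟩
  rw [sub_sub_cancel]
  refine Submodule.sum_mem _ fun k hk => Submodule.smul_mem _ _ (Submodule.subset_span ⟨p ^ k, ?_, rfl⟩)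
  exact Nat.pow_lt_pow_right (Fact.out : p.Prime).one_lt (Finset.mem_range.1 hk)

/-- The span of monomials of length at most `n` -/
def G {d : ℕ} (F : Type) {U : Type} [Field F] [Ring U] [Algebra F U] (X : Fin d → U) (n : ℕ) :
    Submodule F U :=
  Submodule.span F ((fun l : List (Fin d) => (l.map X).prod) '' {l | l.length ≤ n})

variable {d : ℕ}

lemma G_mono (X : Fin d → U) {m n : ℕ} (h : m ≤ n) : G F X m ≤ G F X n :=
  Submodule.span_mono (Set.image_mono fun _ hl => le_trans hl h)

lemma mem_G (X : Fin d → U) (l : List (Fin d)) {n : ℕ} (h : l.length ≤ n) :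
    (l.map X).prod ∈ G F X n := Submodule.subset_span ⟨l, h, rfl⟩

lemma X_mul_G (X : Fin d → U) (i : Fin d) {n : ℕ} {g : U} (hg : g ∈ G F X n) :
    X i * g ∈ G F X (n+1) := by
  induction hg using Submodule.span_induction with
  | mem g hg =>
    obtain ⟨l, hl, rfl⟩ := hg
    simpa using mem_G (F := F) X (i :: l) (n := n+1) (by simpa using hl)
  | zero => simp
  | add a b _ _ ha hb => rw [mul_add]; exact add_mem ha hb
  | smul c a _ ha => rw [mul_smul_comm]; exact Submodule.smul_mem _ _ ha

lemma e_mul_G (e : L →ₗ[F] U) (b : Module.Basis (Fin d) F L) (y : L) {n : ℕ} {g : U}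
    (hg : g ∈ G F (fun i => e (b i)) n) : e y * g ∈ G F (fun i => e (b i)) (n+1) := by
  rw [← b.sum_repr y, map_sum, Finset.sum_mul]
  refine Submodule.sum_mem _ fun i _ => ?_
  rw [map_smul, smul_mul_assoc]
  exact Submodule.smul_mem _ _ (X_mul_G (fun i => e (b i)) i hg)

lemma perm_sub (e : L →ₗ[F] U) (he : ∀ x y, e ⁅x, y⁆ = e x * e y - e y * e x)
    (b : Module.Basis (Fin d) F L) {l l' : List (Fin d)} (h : l.Perm l') :
    (l.map (fun i => e (b i))).prod - (l'.map (fun i => e (b i))).prod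
      ∈ G F (fun i => e (b i)) (l.length - 1) := by
  induction h with
  | nil => simp
  | cons i h ih =>
    rename_i l₁ l₂
    rw [List.map_cons, List.map_cons, List.prod_cons, List.prod_cons, ← mul_sub]
    rcases l₁ with _ | ⟨a, t⟩
    · rw [List.nil_perm.1 h]; simp
    · simpa using e_mul_G e b (b i) ih
  | swap i j l =>
    have : (List.map (fun i => e (b i)) (j :: i :: l)).prod
      - (List.map (fun i => e (b i)) (i :: j :: l)).prod
      = e ⁅b j, b i⁆ * (l.map (fun i => e (b i))).prod := by
      rw [he]; simp [sub_mul, mul_assoc]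
    rw [this]
    exact e_mul_G e b _ (mem_G _ l (by simp))
  | trans h1 h2 ih1 ih2 =>
    rw [← h1.length_eq] at ih2
    simpa using add_mem ih1 ih2

lemma exists_finite [Nontrivial U] [FiniteDimensional F L] (p : ℕ) [Fact p.Prime] [CharP F p]
    (e : L →ₗ[F] U) (he : ∀ x y, e ⁅x, y⁆ = e x * e y - e y * e x)
    (hgen : Algebra.adjoin F (Set.range e) = ⊤) :
    ∃ (d : ℕ) (z : Fin d → Subalgebra.center F U) (T : Set U), T.Finite ∧
      ∀ S : Submodule F U, T ⊆ S → (∀ i, ∀ s ∈ S, (z i : U) * s ∈ S) → S = ⊤ := by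
  let b := Module.finBasis F L
  choose q z hq hz using fun i => exists_central p e he hgen (b i)
  let X := fun i => e (b i)
  let N := ∑ i, q i
  refine ⟨_, z, (fun l : List (Fin _) => (l.map X).prod) '' {l | l.length ≤ N},
    (List.finite_length_le _ _).image _, ?_⟩
  intro S hTS hzS
  have hG : ∀ n, G F X n ≤ S := by
    intro n
    induction n with
    | zero => exact (G_mono X (Nat.zero_le N)).trans (Submodule.span_le.2 hTS)
    | succ n ih =>
      refine Submodule.span_le.2 ?_
      rintro _ ⟨l, hl, rfl⟩
      change (l.map X).prod ∈ S
      by_cases hlN : l.length ≤ N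
      · exact hTS ⟨l, hlN, rfl⟩
      have : ∃ i, q i ≤ l.count i := by
        by_contra! hcon
        apply hlN
        have h1 : ∑ i, Multiset.count i (Multiset.ofList l) = l.length := by
          rw [Multiset.sum_count_eq_card (fun _ _ => Finset.mem_univ _)]; simp
        rw [← h1]
        refine Finset.sum_le_sum fun i _ => ?_
        simpa using (hcon i).le
      obtain ⟨i, hi⟩ := this
      obtain ⟨w, hw⟩ := (List.replicate_sublist_iff.2 hi).exists_perm_append
      have hlen := hw.length_eq
      rw [List.length_append, List.length_replicate] at hlen
      have hl' : l.length ≤ n + 1 := hl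
      have h1 := ih (G_mono X (by omega) (perm_sub e he b hw))
      have h2 : ((List.replicate (q i) i ++ w).map X).prod ∈ S := by
        have h3 : ((List.replicate (q i) i ++ w).map X).prod
            = (z i : U) * (w.map X).prod + (X i ^ q i - z i) * (w.map X).prod := by
          simp [sub_mul]
        rw [h3]
        have hqi := hq i
        refine add_mem (hzS _ _ (ih (mem_G X w (by omega)))) ?_
        have h4 := hz i
        have h5 : ∀ r ∈ Submodule.span F ((fun k : ℕ => e (b i) ^ k) '' Set.Iio (q i)),
            r * (w.map X).prod ∈ S := by
          intro r hr
          induction hr using Submodule.span_induction with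
          | mem r hr =>
            obtain ⟨k, hk, rfl⟩ := hr
            have hk' : k < q i := hk
            have h6 := ih (mem_G X (List.replicate k i ++ w) (by
              rw [List.length_append, List.length_replicate]; omega))
            simpa [X] using h6
          | zero => simp
          | add r s _ _ hr hs => rw [add_mul]; exact add_mem hr hs
          | smul c r _ hr => rw [smul_mul_assoc]; exact Submodule.smul_mem _ _ hr
        exact h5 _ h4
      have := add_mem h1 h2
      rwa [sub_add_cancel] at this
  have hall : ∀ u : U, ∃ n, u ∈ G F X n := by
    have hmul : ∀ u : U, ∀ n, ∀ g ∈ G F X n, ∃ m, u * g ∈ G F X m := by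
      intro u
      have hu : u ∈ Algebra.adjoin F (Set.range e) := by rw [hgen]; trivial
      induction hu using Algebra.adjoin_induction with
      | mem u hu =>
        obtain ⟨y, rfl⟩ := hu
        exact fun n g hg => ⟨n + 1, e_mul_G e b y hg⟩
      | algebraMap r =>
        intro n g hg
        refine ⟨n, ?_⟩
        rw [← Algebra.smul_def]
        exact Submodule.smul_mem _ _ hg
      | add x y _ _ hx hy =>
        intro n g hg
        obtain ⟨m, hm⟩ := hx n g hg
        obtain ⟨m', hm'⟩ := hy n g hg
        refine ⟨max m m', ?_⟩
        rw [add_mul]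
        exact add_mem (G_mono X (le_max_left _ _) hm) (G_mono X (le_max_right _ _) hm')
      | mul x y _ _ hx hy =>
        intro n g hg
        obtain ⟨m, hm⟩ := hy n g hg
        rw [mul_assoc]
        exact hx m _ hm
    intro u
    obtain ⟨m, hm⟩ := hmul u 0 1 (by simpa using mem_G (F := F) X [] (n := 0) (by simp))
    exact ⟨m, by simpa using hm⟩
  rw [eq_top_iff]
  intro u _
  obtain ⟨n, hn⟩ := hall u
  exact hG n hn
end alg
end InjHull

namespace InjHull

lemma main {F U I : Type} [Field F] [Ring U] [Algebra F U]
    [AddCommGroup I] [Module U I] [Module F I] [IsScalarTower F U I]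
    {d : ℕ} (z : Fin d → Subalgebra.center F U) (T : Set U) (hT : T.Finite)
    (h : ∀ S : Submodule F U, T ⊆ S → (∀ i, ∀ s ∈ S, (z i : U) * s ∈ S) → S = ⊤)
    (E : Submodule U I) (hess : E.IsEssentialSub)
    (hE : ∀ m ∈ E, Module.Finite F ((Submodule.span U {m}).restrictScalars F)) :
    IsLocallyFinite F (R := U) (M := I) := by
  let φ : MvPolynomial (Fin d) F →ₐ[F] Subalgebra.center F U := MvPolynomial.aeval z
  let ψ : MvPolynomial (Fin d) F →ₐ[F] U := (Subalgebra.center F U).val.comp φ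
  let alg : Algebra (MvPolynomial (Fin d) F) U := ψ.toRingHom.toAlgebra' (by
    intro c x
    exact ((Subalgebra.mem_center_iff.1 (φ c).2) x).symm)
  have hsm : ∀ (a : MvPolynomial (Fin d) F) (u : U), a • u = ψ a * u := fun a u => rfl
  have : IsScalarTower F (MvPolynomial (Fin d) F) U := by
    refine ⟨fun c a u => ?_⟩
    rw [hsm, hsm, map_smul, smul_mul_assoc]
  let : Module (MvPolynomial (Fin d) F) I := Module.compHom I ψ.toRingHom
  have hsI : ∀ (a : MvPolynomial (Fin d) F) (x : I), a • x = ψ a • x := fun a x => rfl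
  have : IsScalarTower (MvPolynomial (Fin d) F) U I := by
    refine ⟨fun a u x => ?_⟩
    rw [hsm, hsI, mul_smul]
  have : IsScalarTower F (MvPolynomial (Fin d) F) I := by
    refine ⟨fun c a x => ?_⟩
    rw [hsI, hsI, map_smul, smul_assoc]
  have : Module.Finite (MvPolynomial (Fin d) F) U := by
    refine ⟨Submodule.fg_def.2 ⟨T, hT, ?_⟩⟩
    have := h ((Submodule.span (MvPolynomial (Fin d) F) T).restrictScalars F)
      Submodule.subset_span (by
        intro i s hs
        have h1 : (z i : U) * s = (MvPolynomial.X i : MvPolynomial (Fin d) F) • s := by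
          rw [hsm]
          simp [ψ, φ]
        rw [h1]
        exact Submodule.smul_mem (Submodule.span (MvPolynomial (Fin d) F) T) _ hs)
    rw [eq_top_iff]
    intro u _
    have hu : u ∈ (⊤ : Submodule F U) := trivial
    rw [← this] at hu
    exact hu
  exact core (A := MvPolynomial (Fin d) F) E hess hE

lemma adjoin_ι (F L : Type) [Field F] [LieRing L] [LieAlgebra F L] :
    Algebra.adjoin F (Set.range (UniversalEnvelopingAlgebra.ι F : L → _)) = ⊤ := by
  have hs : Function.Surjective (UniversalEnvelopingAlgebra.mkAlgHom F L) :=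
    RingCon.mkₐ_surjective _
  rw [eq_top_iff]
  intro u _
  obtain ⟨t, rfl⟩ := hs u
  induction t using TensorAlgebra.induction with
  | algebraMap r => rw [AlgHom.commutes]; exact Subalgebra.algebraMap_mem _ r
  | ι x => exact Algebra.subset_adjoin ⟨x, rfl⟩
  | mul a b ha hb => rw [map_mul]; exact mul_mem (ha trivial) (hb trivial)
  | add a b ha hb => rw [map_add]; exact add_mem (ha trivial) (hb trivial)

section uea
attribute [local instance] LieRing.ofAssociativeRing

lemma nontrivial_U (F L : Type) [Field F] [LieRing L] [LieAlgebra F L] :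
    Nontrivial (UniversalEnvelopingAlgebra F L) :=
  (UniversalEnvelopingAlgebra.lift F (0 : L →ₗ⁅F⁆ F)).toRingHom.domain_nontrivial

lemma exists_finite_U (F : Type) [Field F] (p : ℕ) [Fact p.Prime] [CharP F p]
    (L : Type) [LieRing L] [LieAlgebra F L] [FiniteDimensional F L] :
    ∃ (d : ℕ) (z : Fin d → Subalgebra.center F (UniversalEnvelopingAlgebra F L))
      (T : Set (UniversalEnvelopingAlgebra F L)), T.Finite ∧
      ∀ S : Submodule F (UniversalEnvelopingAlgebra F L), T ⊆ S →
        (∀ i, ∀ s ∈ S, (z i : UniversalEnvelopingAlgebra F L) * s ∈ S) → S = ⊤ := by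
  have := nontrivial_U F L
  refine exists_finite (F := F) (L := L) p
    ((UniversalEnvelopingAlgebra.ι F : L →ₗ⁅F⁆ UniversalEnvelopingAlgebra F L) :
      L →ₗ[F] UniversalEnvelopingAlgebra F L) ?_ (adjoin_ι F L)
  intro x y
  rw [LieHom.coe_toLinearMap, LieHom.map_lie, LieRing.of_associative_ring_bracket]

end uea

end InjHull

/-- Over a field of prime characteristic, the injective hull of every locally
finite module over the universal enveloping algebra of a finite-dimensional Lie algebra
is locally finite. -/
theorem injective_hull_locallyFinite
    (F : Type) [Field F] (p : ℕ) [Fact p.Prime] [CharP F p]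
    (L : Type) [LieRing L] [LieAlgebra F L] [FiniteDimensional F L]
    (M : Type) [AddCommGroup M] [Module (UniversalEnvelopingAlgebra F L) M]
    [Module F M] [IsScalarTower F (UniversalEnvelopingAlgebra F L) M]
    (I : Type) [AddCommGroup I] [Module (UniversalEnvelopingAlgebra F L) I]
    [Module F I] [IsScalarTower F (UniversalEnvelopingAlgebra F L) I]
    (f : M →ₗ[UniversalEnvelopingAlgebra F L] I) (hf : Function.Injective f)
    (hinj : Module.Injective (UniversalEnvelopingAlgebra F L) I)
    (hess : (LinearMap.range f).IsEssentialSub)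
    (hM : IsLocallyFinite F (R := UniversalEnvelopingAlgebra F L) (M := M)) :
    IsLocallyFinite F (R := UniversalEnvelopingAlgebra F L) (M := I) := by
  obtain ⟨d, z, T, hT, h⟩ := InjHull.exists_finite_U F p L
  refine InjHull.main z T hT h (LinearMap.range f) hess ?_
  rintro _ ⟨m, rfl⟩
  have h1 := hM m
  have h2 : (Submodule.span (UniversalEnvelopingAlgebra F L) {f m}).restrictScalars F
      = ((Submodule.span (UniversalEnvelopingAlgebra F L) {m}).restrictScalars F).map
        (f.restrictScalars F) := by
    rw [← Set.image_singleton, ← Submodule.map_span]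
    rfl
  rw [h2]
  infer_instance
end

section
/- Let 𝔰 be a finite-dimensional semisimple Lie algebra over a field of characteristic zero. If the one-dimensional trivial module F is an injective U(𝔰)-module, then 𝔰 = 0. -/
open scoped TensorProduct

/-- `gl(V)` acts by (quadratic) vector fields on the affine chart `a = 1` of projective space. -/
theorem aux_chart (K V : Type) [Field K] [AddCommGroup V] [Module K V] (a : V) (ha : a ≠ 0) :
    ∃ (σ : Type) (φ : V →ₗ[K] MvPolynomial σ K)
      (D : Module.End K V →ₗ[K] Derivation K (MvPolynomial σ K) (MvPolynomial σ K)),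
      φ a = 1 ∧ (∀ X v, D X (φ v) = φ (X v) - φ v * φ (X a)) ∧
      ∀ X Y : Module.End K V, D (X * Y - Y * X) = ⁅D X, D Y⁆ := by
  classical
  have hli : LinearIndepOn K id ({a} : Set V) := LinearIndepOn.singleton ha
  let e := Module.Basis.extend hli
  have hmem : a ∈ hli.extend (Set.subset_univ _) := hli.subset_extend _ (Set.mem_singleton a)
  let i0 : hli.extend (Set.subset_univ ({a} : Set V)) := ⟨a, hmem⟩
  have hei0 : e i0 = a := Module.Basis.extend_apply_self hli i0
  let σ := hli.extend (Set.subset_univ ({a} : Set V))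
  let φ : V →ₗ[K] MvPolynomial σ K :=
    e.constr K (fun i => if i = i0 then 1 else MvPolynomial.X i)
  have hφ : ∀ i, φ (e i) = if i = i0 then 1 else MvPolynomial.X i := fun i => by
    simp only [φ, Module.Basis.constr_basis]
  have hφa : φ a = 1 := by rw [← hei0, hφ]; simp
  let D : Module.End K V →ₗ[K] Derivation K (MvPolynomial σ K) (MvPolynomial σ K) :=
    (MvPolynomial.mkDerivationEquiv K).toLinearMap ∘ₗ
      { toFun := fun X i => φ (X (e i)) - φ (e i) * φ (X a)
        map_add' := fun X Y => by
          ext1 i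
          simp only [LinearMap.add_apply, map_add, Pi.add_apply]; ring
        map_smul' := fun c X => by
          ext1 i
          simp only [LinearMap.smul_apply, map_smul, Pi.smul_apply, RingHom.id_apply,
            mul_smul_comm, smul_sub] }
  have hDX : ∀ X i, D X (MvPolynomial.X i) = φ (X (e i)) - φ (e i) * φ (X a) := fun X i =>
    MvPolynomial.mkDerivation_X K _ i
  have hD : ∀ X v, D X (φ v) = φ (X v) - φ v * φ (X a) := by
    intro X v
    let f1 : V →ₗ[K] MvPolynomial σ K := (D X).toLinearMap ∘ₗ φ
    let f2 : V →ₗ[K] MvPolynomial σ K :=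
      φ ∘ₗ X - (LinearMap.mulRight K (φ (X a))) ∘ₗ φ
    have : f1 = f2 := by
      apply e.ext
      intro i
      change D X (φ (e i)) = φ (X (e i)) - φ (e i) * φ (X a)
      by_cases hi : i = i0
      · subst hi
        rw [hei0, hφa]; simp
      · rw [← hDX, hφ, if_neg hi]
    exact LinearMap.congr_fun this v
  refine ⟨σ, φ, D, hφa, hD, ?_⟩
  intro X Y
  apply MvPolynomial.derivation_ext
  intro i
  rw [Derivation.commutator_apply, hDX, hDX, hDX, map_sub, map_sub, Derivation.leibniz,
    Derivation.leibniz, hD, hD, hD, hD, hD, hD]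
  simp only [LinearMap.sub_apply, Module.End.mul_apply, map_sub, smul_eq_mul]
  ring

attribute [local instance] LieRing.ofAssociativeRing

/-- Consequence of injectivity of the trivial module. -/
theorem aux_retract
    (F : Type) [Field F]
    (L : Type) [LieRing L] [LieAlgebra F L]
    (T : Type) [AddCommGroup T] [Module (UniversalEnvelopingAlgebra F L) T]
    [Module F T] [IsScalarTower F (UniversalEnvelopingAlgebra F L) T]
    (htriv : ∀ (x : L) (t : T), (UniversalEnvelopingAlgebra.ι F x :
      UniversalEnvelopingAlgebra F L) • t = 0)
    (hdim : Module.finrank F T = 1)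
    (hinj : Module.Injective (UniversalEnvelopingAlgebra F L) T)
    (M : Type) [AddCommGroup M] [Module F M] (ρ : L →ₗ⁅F⁆ Module.End F M)
    (m0 : M) (hm0 : m0 ≠ 0) (hρ : ∀ x, ρ x m0 = 0) :
    ∃ r : M →+ T, (∀ x m, r (ρ x m) = 0) ∧ r m0 ≠ 0 := by
  let P : UniversalEnvelopingAlgebra F L →ₐ[F] Module.End F M :=
    UniversalEnvelopingAlgebra.lift F ρ
  have hP : ∀ x, P (UniversalEnvelopingAlgebra.ι F x) = ρ x := fun x =>
    UniversalEnvelopingAlgebra.lift_ι_apply F ρ x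
  let _ : Module (UniversalEnvelopingAlgebra F L) M := Module.compHom M P.toRingHom
  have hsm : ∀ (u : UniversalEnvelopingAlgebra F L) (m : M), u • m = P u m := fun _ _ => rfl
  have : FiniteDimensional F T := FiniteDimensional.of_finrank_pos (by omega)
  have e : T ≃ₗ[F] F := LinearEquiv.ofFinrankEq T F (by rw [hdim, Module.finrank_self])
  let f0 : T →ₗ[F] M := (LinearMap.toSpanSingleton F M m0) ∘ₗ e.toLinearMap
  have hf0 : ∀ t, f0 t = e t • m0 := fun t => rfl
  have hind : ∀ (u : UniversalEnvelopingAlgebra F L), ∀ t, f0 (u • t) = u • f0 t := by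
    intro u
    obtain ⟨w, rfl⟩ : ∃ w, UniversalEnvelopingAlgebra.mkAlgHom F L w = u :=
      RingCon.mk'_surjective _ u
    induction w using TensorAlgebra.induction with
    | algebraMap c =>
      intro t
      rw [AlgHom.commutes, hsm, AlgHom.commutes, algebraMap_smul, map_smul]
      rfl
    | ι x =>
      intro t
      have h : UniversalEnvelopingAlgebra.mkAlgHom F L (TensorAlgebra.ι F x)
        = UniversalEnvelopingAlgebra.ι F x := rfl
      rw [h, htriv, hsm, hP, hf0 t, map_smul, hρ, smul_zero, map_zero]
    | mul a b ha hb =>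
      intro t
      rw [map_mul, mul_smul, mul_smul, ha, hb]
    | add a b ha hb =>
      intro t
      rw [map_add, add_smul, add_smul, map_add, ha, hb]
  let f : T →ₗ[UniversalEnvelopingAlgebra F L] M :=
    { toFun := f0, map_add' := f0.map_add, map_smul' := hind }
  have hf : Function.Injective f := by
    intro s t hst
    have h : e s • m0 = e t • m0 := hst
    exact e.injective (smul_left_injective F hm0 h)
  obtain ⟨r, hr⟩ := hinj.out f hf LinearMap.id
  refine ⟨r.toAddMonoidHom, fun x m => ?_, ?_⟩
  · change r (ρ x m) = 0
    rw [← hP, ← hsm, map_smul, htriv]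
  · change r m0 ≠ 0
    have h1 : f (e.symm 1) = m0 := by
      change e (e.symm 1) • m0 = m0
      simp
    rw [← h1, hr]
    simp

/-- Over an algebraically closed field, an element with nonzero `ad` yields `y, b` with
`[y,b] ≠ 0` and `[y,[y,b]] = 0`. -/
theorem aux_elem (K G : Type) [Field K] [IsAlgClosed K] [LieRing G] [LieAlgebra K G]
    [FiniteDimensional K G] (x z : G) (hx : ⁅x, z⁆ ≠ 0) :
    ∃ y b : G, ⁅y, b⁆ ≠ 0 ∧ ⁅y, ⁅y, b⁆⁆ = 0 := by
  let g : Module.End K G := LieAlgebra.ad K G x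
  have hg : ∀ v, g v = ⁅x, v⁆ := fun v => rfl
  by_cases h : ∃ μ : K, μ ≠ 0 ∧ g.HasEigenvalue μ
  · obtain ⟨μ, hμ, he⟩ := h
    obtain ⟨v, hv⟩ := he.exists_hasEigenvector
    have h1 : ⁅x, v⁆ = μ • v := hv.apply_eq_smul
    have h2 : ⁅v, x⁆ ≠ 0 := by
      rw [← lie_skew, h1, neg_ne_zero]
      exact smul_ne_zero hμ hv.2
    refine ⟨v, x, h2, ?_⟩
    rw [← lie_skew v x, h1]
    simp
  · push Not at h
    have hnil : IsNilpotent g := by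
      have htop : g.maxGenEigenspace 0 = ⊤ := by
        rw [eq_top_iff, ← Module.End.iSup_maxGenEigenspace_eq_top g]
        refine iSup_le fun μ => ?_
        by_cases hμ : μ = 0
        · rw [hμ]
        · have h3 := h μ hμ
          have : g.maxGenEigenspace μ = ⊥ := by
            by_contra hne
            apply h3
            obtain ⟨w, hw, hw0⟩ := Submodule.exists_mem_ne_zero_of_ne_bot hne
            obtain ⟨k, hk⟩ := Module.End.mem_maxGenEigenspace g μ w |>.1 hw
            refine Module.End.hasEigenvalue_of_hasGenEigenvalue (k := k) ?_
            refine fun hb => hw0 ?_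
            have : w ∈ g.genEigenspace μ k := by
              rw [Module.End.mem_genEigenspace_nat]
              exact hk
            rw [hb] at this
            simpa using this
          rw [this]; exact bot_le
      refine ⟨Module.finrank K G, ?_⟩
      ext v
      have hv : v ∈ g.maxGenEigenspace 0 := htop ▸ Submodule.mem_top
      rw [Module.End.maxGenEigenspace_eq_genEigenspace_finrank,
        Module.End.mem_genEigenspace_nat] at hv
      simpa using hv
    have hne : ∃ n, (g ^ n) z = 0 := by
      obtain ⟨n, hn⟩ := hnil
      exact ⟨n, by rw [hn]; rfl⟩
    classical
    let n := Nat.find hne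
    have hn : (g ^ n) z = 0 := Nat.find_spec hne
    have hmin : ∀ m < n, (g ^ m) z ≠ 0 := fun m hm => Nat.find_min hne hm
    obtain ⟨k, hk⟩ : ∃ k, n = k + 2 := by
      have h0 : n ≠ 0 := by
        intro h0
        rw [h0] at hn
        apply hx
        have : z = 0 := by simpa using hn
        rw [this, lie_zero]
      have h1 : n ≠ 1 := by
        intro h1
        rw [h1] at hn
        apply hx
        simpa [hg] using hn
      exact ⟨n - 2, by omega⟩
    refine ⟨x, (g ^ k) z, ?_, ?_⟩
    · have := hmin (k + 1) (by omega)
      rwa [pow_succ', Module.End.mul_apply] at this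
    · rw [hk, pow_succ', pow_succ', Module.End.mul_apply, Module.End.mul_apply] at hn
      exact hn

/-- Let `𝔰` be a finite-dimensional semisimple Lie algebra over a field of
characteristic zero. If the one-dimensional trivial module is injective over `U(𝔰)`,
then `𝔰 = 0`. -/
theorem semisimple_trivial_injective_implies_zero
    (F : Type) [Field F] [CharZero F]
    (L : Type) [LieRing L] [LieAlgebra F L] [FiniteDimensional F L]
    [LieAlgebra.IsSemisimple F L]
    -- `T` is the one-dimensional trivial `U(𝔰)`-module
    (T : Type) [AddCommGroup T] [Module (UniversalEnvelopingAlgebra F L) T]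
    [Module F T] [IsScalarTower F (UniversalEnvelopingAlgebra F L) T]
    (htriv : ∀ (x : L) (t : T), (UniversalEnvelopingAlgebra.ι F x :
      UniversalEnvelopingAlgebra F L) • t = 0)
    (hdim : Module.finrank F T = 1)
    (hinj : Module.Injective (UniversalEnvelopingAlgebra F L) T) :
    Subsingleton L := by
  by_contra hL
  have hab : ¬ IsLieAbelian L := fun h =>
    hL (LieAlgebra.subsingleton_of_hasTrivialRadical_lie_abelian F L)
  obtain ⟨x, z, hxz⟩ : ∃ x z : L, ⁅x, z⁆ ≠ 0 := by
    by_contra hcon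
    push Not at hcon
    exact hab ⟨hcon⟩
  let K := AlgebraicClosure F
  let G := K ⊗[F] L
  have hxz' : ⁅((1 : K) ⊗ₜ[F] x : G), ((1 : K) ⊗ₜ[F] z : G)⁆ ≠ 0 := by
    rw [LieAlgebra.ExtendScalars.bracket_tmul]
    intro h0
    apply hxz
    have hinj' : Function.Injective (TensorProduct.mk F K L 1) :=
      Module.FaithfullyFlat.tensorProduct_mk_injective L
    apply hinj'
    rw [map_zero]
    simpa using h0
  obtain ⟨y, b, hyb, hyyb⟩ := aux_elem K G _ _ hxz'
  obtain ⟨σ, φ, D, hφ, hD, hlie⟩ := aux_chart K G ⁅y, b⁆ hyb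
  let ρ : L →ₗ⁅F⁆ Module.End F (MvPolynomial σ K) :=
    { toFun := fun x =>
        (D (LieAlgebra.ad K G ((1 : K) ⊗ₜ[F] x))).toLinearMap.restrictScalars F
      map_add' := fun u v => by
        refine LinearMap.ext fun p => ?_
        simp [TensorProduct.tmul_add]
      map_smul' := fun c u => by
        refine LinearMap.ext fun p => ?_
        have : ((1 : K) ⊗ₜ[F] (c • u) : G) = (algebraMap F K c) • ((1 : K) ⊗ₜ[F] u : G) := by
          rw [algebraMap_smul, TensorProduct.tmul_smul]
        rw [this, map_smul, map_smul]
        simp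
      map_lie' := fun {u v} => by
        refine LinearMap.ext fun p => ?_
        have : ((1 : K) ⊗ₜ[F] ⁅u, v⁆ : G) = ⁅((1 : K) ⊗ₜ[F] u : G), ((1 : K) ⊗ₜ[F] v : G)⁆ := by
          rw [LieAlgebra.ExtendScalars.bracket_tmul, one_mul]
        rw [this, LieHom.map_lie, LieRing.of_associative_ring_bracket, hlie,
          LieRing.of_associative_ring_bracket]
        exact Derivation.commutator_apply (D1 := D _) (D2 := D _) p }
  have hρ : ∀ u p, ρ u p = D (LieAlgebra.ad K G ((1 : K) ⊗ₜ[F] u)) p := fun _ _ => rfl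
  obtain ⟨r, hr, hr1⟩ := aux_retract F L T htriv hdim hinj (MvPolynomial σ K) ρ 1 one_ne_zero
    (fun u => by rw [hρ]; exact Derivation.map_one_eq_zero _)
  apply hr1
  have key : ∀ (w : G) p, r (D (LieAlgebra.ad K G w) p) = 0 := by
    intro w
    induction w using TensorProduct.induction_on with
    | zero => intro p; simp
    | tmul k u =>
      intro p
      have : (k ⊗ₜ[F] u : G) = k • ((1 : K) ⊗ₜ[F] u : G) := by
        rw [TensorProduct.smul_tmul', smul_eq_mul, mul_one]
      rw [this, map_smul, map_smul, Derivation.smul_apply, ← Derivation.map_smul, ← hρ, hr]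
    | add a b ha hb =>
      intro p
      rw [map_add, map_add, Derivation.add_apply, map_add, ha, hb, add_zero]
  have h := key y (φ b)
  rw [hD, LieAlgebra.ad_apply, LieAlgebra.ad_apply, hyyb, hφ, map_zero, mul_zero, sub_zero] at h
  exact h
end

section
/- Let 𝔞 be a nonzero finite-dimensional Lie algebra over a field F of prime characteristic and let M be a nonzero finitely generated U(𝔞)-module. Then the injective dimension of M over U(𝔞) equals dim_F 𝔞. In particular, M is not injective. -/
open CategoryTheory

universe u

/-- The `n`-th Ext group over the `F`-algebra `R`, as a functor value on modules. -/
noncomputable def ExtGrp (F : Type u) [Field F] (R : Type u) [Ring R] [Algebra F R]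
    (X M : ModuleCat.{u} R) (n : ℕ) : ModuleCat F :=
  ((Ext F (ModuleCat.{u} R) n).obj (Opposite.op X)).obj M

/-- `M` has injective dimension exactly `d`: all Ext groups `Ext^n(-, M)` vanish for
`n > d`, and `Ext^d(X, M) ≠ 0` for some `X`. -/
def InjDimEq (F : Type u) [Field F] (R : Type u) [Ring R] [Algebra F R]
    (M : ModuleCat.{u} R) (d : ℕ) : Prop :=
  (∀ (X : ModuleCat.{u} R) (n : ℕ), d < n → Subsingleton (ExtGrp F R X M n)) ∧
  ∃ X : ModuleCat.{u} R, Nontrivial (ExtGrp F R X M d)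

section fil
variable {F : Type*} [Field F] {V : Type*} [AddCommGroup V] [Module F V] {I : Type*}

/-- The filtration by degree attached to a family of vectors. -/
def fil (β : I → V) (deg : I → ℕ) (n : ℕ) : Submodule F V :=
  Submodule.span F (β '' {i | deg i < n})

theorem mem_fil (β : I → V) (deg : I → ℕ) {n : ℕ} {i : I} (h : deg i < n) :
    β i ∈ fil (F := F) β deg n := Submodule.subset_span ⟨i, h, rfl⟩

theorem fil_mono (β : I → V) (deg : I → ℕ) {n n' : ℕ} (h : n ≤ n') :
    fil (F := F) β deg n ≤ fil β deg n' :=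
  Submodule.span_mono (Set.image_mono fun i (hi : deg i < n) => lt_of_lt_of_le hi h)

theorem fil_zero (β : I → V) (deg : I → ℕ) : fil (F := F) β deg 0 = ⊥ := by
  simp [fil]

theorem fil_le (β : I → V) (deg : I → ℕ) {n : ℕ} {W : Submodule F V}
    (h : ∀ i, deg i < n → β i ∈ W) : fil (F := F) β deg n ≤ W := by
  rw [fil, Submodule.span_le]
  rintro _ ⟨i, hi, rfl⟩
  exact h i hi

theorem exists_mem_fil (β : I → V) (deg : I → ℕ) (hspan : ⊤ ≤ Submodule.span F (Set.range β))
    (v : V) : ∃ n, v ∈ fil (F := F) β deg n := by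
  have hv : v ∈ Submodule.span F (Set.range β) := hspan trivial
  induction hv using Submodule.span_induction with
  | mem x h => obtain ⟨i, rfl⟩ := h; exact ⟨deg i + 1, mem_fil β deg (Nat.lt_succ_self _)⟩
  | zero => exact ⟨0, zero_mem _⟩
  | add x y _ _ hx hy =>
    obtain ⟨a, ha⟩ := hx
    obtain ⟨b, hb⟩ := hy
    exact ⟨max a b, add_mem (fil_mono β deg (le_max_left _ _) ha)
      (fil_mono β deg (le_max_right _ _) hb)⟩
  | smul a x _ hx => obtain ⟨n, hn⟩ := hx; exact ⟨n, Submodule.smul_mem _ _ hn⟩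

/-- unitriangular change of basis -/
theorem tri_indep (β : Module.Basis I F V) (deg : I → ℕ) (c : I → V)
    (h : ∀ i, c i - β i ∈ fil (F := F) β deg (deg i)) : LinearIndependent F c := by
  let T : V →ₗ[F] V := β.constr F c
  have hT : ∀ n, ∀ v ∈ fil (F := F) β deg (n+1), T v - v ∈ fil (F := F) β deg n := by
    intro n
    have : fil (F := F) β deg (n+1) ≤ (fil (F := F) β deg n).comap (T - LinearMap.id) := by
      refine fil_le _ _ fun i hi => ?_
      simp only [Submodule.mem_comap, LinearMap.sub_apply, LinearMap.id_apply, T,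
        Module.Basis.constr_basis]
      exact fil_mono β deg (by omega) (h i)
    exact this
  have hinj : Function.Injective T := by
    rw [injective_iff_map_eq_zero]
    intro v hv
    obtain ⟨n, hn⟩ := exists_mem_fil (F := F) β deg β.span_eq.ge v
    induction n with
    | zero => simpa [fil_zero] using hn
    | succ n ih =>
      apply ih
      simpa [hv] using hT n v hn
  have := β.linearIndependent.map' T (LinearMap.ker_eq_bot.2 hinj)
  have hc : (T : V → V) ∘ β = c := by
    ext i
    simp [T]
  rwa [hc] at this

theorem tri_span (β : I → V) (deg : I → ℕ) (c : I → V)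
    (h : ∀ i, c i - β i ∈ fil (F := F) β deg (deg i)) (n : ℕ) :
    fil (F := F) β deg n ≤ fil c deg n := by
  induction n with
  | zero => simp [fil_zero]
  | succ n ih =>
    refine fil_le _ _ fun i hi => ?_
    have h1 := fil_mono (F := F) c deg (Nat.le_succ n) (ih (fil_mono β deg (by omega : deg i ≤ n) (h i)))
    have h2 := mem_fil (F := F) c deg hi
    simpa using sub_mem h2 h1
end fil

section PBW
variable {F : Type u} [Field F] {L : Type u} [LieRing L] [LieAlgebra F L] {d : ℕ}

/-- the monomial with exponent `m` -/
noncomputable def zz (F : Type u) [Field F] {d : ℕ} (m : Fin d →₀ ℕ) : (Fin d →₀ ℕ) →₀ F :=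
  Finsupp.single m 1

/-- exponent of a single variable -/
noncomputable def dl {d : ℕ} (i : Fin d) : Fin d →₀ ℕ := Finsupp.single i 1

theorem degree_add_dl (m : Fin d →₀ ℕ) (i : Fin d) : (m + dl i).degree = m.degree + 1 := by
  simp [dl]

/-- all letters of `m` are at least `i` -/
def Low (i : Fin d) (m : Fin d →₀ ℕ) : Prop := ∀ k ∈ m.support, i ≤ k

theorem Low.add {i j : Fin d} {m : Fin d →₀ ℕ} (h : Low i m) (hj : i ≤ j) : Low i (m + dl j) := by
  classical
  intro k hk
  rcases Finset.mem_union.1 (Finsupp.support_add hk) with h1 | h1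
  · exact h k h1
  · have := Finsupp.support_single_subset h1
    simp only [Finset.mem_singleton] at this
    rw [this]; exact hj

theorem exists_low (m : Fin d →₀ ℕ) (hm : m ≠ 0) : ∃ j N, m = N + dl j ∧ Low j N := by
  have h : m.support.Nonempty := Finsupp.support_nonempty_iff.2 hm
  refine ⟨m.support.min' h, m - dl (m.support.min' h), ?_, ?_⟩
  · have h1 := m.support.min'_mem h
    rw [tsub_add_cancel_of_le]
    rw [dl, Finsupp.single_le_iff]
    have := Finsupp.mem_support_iff.1 h1
    omega
  · intro k hk
    refine Finset.min'_le _ _ ?_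
    rw [Finsupp.mem_support_iff] at hk ⊢
    rw [Finsupp.tsub_apply] at hk
    omega

open Classical in
/-- the recursive definition of the action of the Lie algebra on the polynomial space -/
noncomputable def act (e : Module.Basis (Fin d) F L) :
    ℕ → Fin d → ((Fin d →₀ ℕ) →₀ F) →ₗ[F] ((Fin d →₀ ℕ) →₀ F)
  | 0, i => Finsupp.linearCombination F (fun m => zz F (m + dl i))
  | n+1, i => Finsupp.linearCombination F (fun m =>
      if m.degree ≤ n then act e n i (zz F m) else
      if h : ∃ j N, m = N + dl j ∧ Low j N ∧ j < i then
        zz F (m + dl i) + act e n h.choose (act e n i (zz F h.choose_spec.choose)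
            - zz F (h.choose_spec.choose + dl i))
          + ∑ k, e.repr ⁅e i, e h.choose⁆ k • act e n k (zz F h.choose_spec.choose)
      else zz F (m + dl i))

theorem act_stable (e : Module.Basis (Fin d) F L) (n : ℕ) (i : Fin d) (m : Fin d →₀ ℕ)
    (h : m.degree ≤ n) : act e n i (zz F m) = act e m.degree i (zz F m) := by
  induction n with
  | zero => rw [Nat.le_zero.1 h]
  | succ n ih =>
    rcases h.lt_or_eq with h | h
    · rw [← ih (by omega), act, zz, Finsupp.linearCombination_single, one_smul,
        if_pos (by omega), zz]
    · rw [h]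

/-- the action of basis vectors -/
noncomputable def XX (e : Module.Basis (Fin d) F L) (i : Fin d) :
    ((Fin d →₀ ℕ) →₀ F) →ₗ[F] ((Fin d →₀ ℕ) →₀ F) :=
  Finsupp.linearCombination F (fun m => act e m.degree i (zz F m))

/-- degree filtration of the polynomial space -/
noncomputable abbrev vf (F : Type u) [Field F] (d : ℕ) (n : ℕ) : Submodule F ((Fin d →₀ ℕ) →₀ F) :=
  fil (zz F) (fun m => m.degree) n

theorem XX_zz (e : Module.Basis (Fin d) F L) (i : Fin d) (m : Fin d →₀ ℕ) :
    XX e i (zz F m) = act e m.degree i (zz F m) := by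
  rw [XX]; conv_lhs => rw [zz]
  rw [Finsupp.linearCombination_single, one_smul]

theorem act_eq (e : Module.Basis (Fin d) F L) (n : ℕ) (i : Fin d) (v)
    (hv : v ∈ vf F d (n+1)) : act e n i v = XX e i v := by
  have : vf F d (n+1) ≤ LinearMap.ker (act e n i - XX e i) := by
    refine fil_le _ _ fun m hm => ?_
    rw [LinearMap.mem_ker, LinearMap.sub_apply, XX_zz, act_stable e n i m (by omega), sub_self]
  simpa [sub_eq_zero] using this hv

/-- action of Lie algebra elements -/
noncomputable def XL (e : Module.Basis (Fin d) F L) :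
    L →ₗ[F] Module.End F ((Fin d →₀ ℕ) →₀ F) := e.constr F (XX e)

theorem XL_e (e : Module.Basis (Fin d) F L) (i : Fin d) : XL e (e i) = XX e i := by
  simp [XL]

theorem XL_apply (e : Module.Basis (Fin d) F L) (y : L) (v) :
    XL e y v = ∑ k, e.repr y k • XX e k v := by
  simp [XL, Module.Basis.constr_apply_fintype]

theorem XX_basic (e : Module.Basis (Fin d) F L) (n : ℕ) : ∀ (i : Fin d) (m : Fin d →₀ ℕ),
    m.degree = n → (XX e i (zz F m) - zz F (m + dl i) ∈ vf F d (n+1)) ∧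
    (Low i m → XX e i (zz F m) = zz F (m + dl i)) ∧
    ∀ j N, m = N + dl j → Low j N → j < i →
      XX e i (zz F m) = zz F (m + dl i) + XX e j (XX e i (zz F N) - zz F (N + dl i))
        + XL e ⁅e i, e j⁆ (zz F N) := by
  induction n using Nat.strong_induction_on with
  | _ n ih =>
  intro i m hm
  have hmap : ∀ (k : Fin d) (t : ℕ), t < n + 1 → ∀ v ∈ vf F d t, XX e k v ∈ vf F d (t+1) := by
    intro k t ht
    have : vf F d t ≤ (vf F d (t+1)).comap (XX e k) := by
      refine fil_le _ _ fun m' hm' => ?_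
      rw [Submodule.mem_comap]
      have h1 := (ih m'.degree (by omega) k m' rfl).1
      have h2 : zz F (m' + dl k) ∈ vf F d (t+1) :=
        mem_fil _ _ (by rw [degree_add_dl]; omega)
      have := add_mem (fil_mono _ _ (by omega) h1) h2
      simpa using this
    exact this
  have hcase : ∀ j N, m = N + dl j → Low j N → j < i →
      XX e i (zz F m) = zz F (m + dl i) + XX e j (XX e i (zz F N) - zz F (N + dl i))
        + XL e ⁅e i, e j⁆ (zz F N) := by
    intro j N hN hj hji
    obtain ⟨n, rfl⟩ : ∃ n', n = n' + 1 := ⟨N.degree, by rw [← hm, hN, degree_add_dl]⟩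
    have h : ∃ j N, m = N + dl j ∧ Low j N ∧ j < i := ⟨j, N, hN, hj, hji⟩
    have hu : XX e i (zz F m) = zz F (m + dl i) + act e n h.choose (act e n i (zz F h.choose_spec.choose)
            - zz F (h.choose_spec.choose + dl i))
          + ∑ k, e.repr ⁅e i, e h.choose⁆ k • act e n k (zz F h.choose_spec.choose) := by
      rw [XX_zz, hm, act]
      conv_lhs => rw [zz]
      rw [Finsupp.linearCombination_single, one_smul, if_neg (by omega), dif_pos h]
    have hjj : ∀ j' N', m = N' + dl j' → Low j' N' → j' = j ∧ N' = N := by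
      intro j' N' h1 h2
      have hm1 : j ≤ j' := by
        refine (hj.add le_rfl) j' ?_
        rw [← hN, h1, Finsupp.mem_support_iff]; simp [dl]
      have hm2 : j' ≤ j := by
        refine (h2.add le_rfl) j ?_
        rw [← h1, hN, Finsupp.mem_support_iff]; simp [dl]
      have := le_antisymm hm1 hm2
      subst this
      exact ⟨rfl, add_right_cancel (h1.symm.trans hN)⟩
    obtain ⟨hj', hN'⟩ := hjj h.choose h.choose_spec.choose h.choose_spec.choose_spec.1
      h.choose_spec.choose_spec.2.1
    rw [hN', hj'] at hu
    have hd : N.degree = n := by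
      rw [hN, degree_add_dl] at hm; omega
    have hNm : zz F N ∈ vf F d (n+1) := mem_fil _ _ (by omega)
    rw [hu, act_eq e n i _ hNm, act_eq e n j _ ((ih n (by omega) i N hd).1), XL_apply]
    simp_rw [act_eq e n _ _ hNm]
  have hlow : Low i m → XX e i (zz F m) = zz F (m + dl i) := by
    intro hl
    rw [XX_zz, hm]
    cases n with
    | zero => rw [act, zz, Finsupp.linearCombination_single, one_smul]
    | succ n =>
      have h : ¬ ∃ j N, m = N + dl j ∧ Low j N ∧ j < i := by
        rintro ⟨j, N, rfl, h1, h2⟩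
        refine absurd (hl j ?_) (not_le.2 h2)
        rw [Finsupp.mem_support_iff]; simp [dl]
      rw [act]
      conv_lhs => rw [zz]
      rw [Finsupp.linearCombination_single, one_smul, if_neg (by omega), dif_neg h]
  refine ⟨?_, hlow, hcase⟩
  by_cases hl : Low i m
  · rw [hlow hl, sub_self]; exact zero_mem _
  · have hm0 : m ≠ 0 := by
      rintro rfl
      apply hl
      intro k hk
      simp at hk
    obtain ⟨j, N, hN, hj⟩ := exists_low m hm0
    have hji : j < i := by
      by_contra hc
      rw [not_lt] at hc
      apply hl
      rw [hN]
      refine Low.add ?_ hc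
      intro k hk
      exact hc.trans (hj k hk)
    rw [hcase j N hN hj hji]
    have hd : N.degree + 1 = n := by
      rw [hN, degree_add_dl] at hm; omega
    have h1 := hmap j n (by omega) _ (hd ▸ (ih N.degree (by omega) i N rfl).1)
    have h2 : XL e ⁅e i, e j⁆ (zz F N) ∈ vf F d (n+1) := by
      rw [XL_apply]
      refine sum_mem fun k _ => Submodule.smul_mem _ _ (hmap k n (by omega) _ ?_)
      exact mem_fil _ _ (by omega)
    rw [add_assoc, add_sub_cancel_left]
    exact add_mem h1 h2

theorem XX_lead (e : Module.Basis (Fin d) F L) (i : Fin d) (m : Fin d →₀ ℕ) :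
    XX e i (zz F m) - zz F (m + dl i) ∈ vf F d (m.degree+1) := (XX_basic e _ i m rfl).1

theorem XX_low (e : Module.Basis (Fin d) F L) (i : Fin d) (m : Fin d →₀ ℕ) (h : Low i m) :
    XX e i (zz F m) = zz F (m + dl i) := (XX_basic e _ i m rfl).2.1 h

theorem XX_comm_low (e : Module.Basis (Fin d) F L) (i j : Fin d) (N : Fin d →₀ ℕ) (h : Low j N)
    (hji : j < i) : XX e i (XX e j (zz F N)) = XX e j (XX e i (zz F N)) + XL e ⁅e i, e j⁆ (zz F N) := by
  rw [XX_low e j N h, (XX_basic e _ i (N + dl j) rfl).2.2 j N rfl h hji, map_sub,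
    XX_low e j (N + dl i) (h.add hji.le)]
  rw [add_assoc N, add_comm (dl j), ← add_assoc]
  abel

/-- closed under commutation -/
theorem XX_comm_low' (i j : Fin d) (N : Fin d →₀ ℕ) (h : Low i N ∨ Low j N) :
    (i = j) ∨ (Low j N ∧ j < i) ∨ (Low i N ∧ i < j) := by
  rcases lt_trichotomy i j with hij | hij | hij
  · right; right
    refine ⟨?_, hij⟩
    rcases h with h | h
    · exact h
    · intro k hk; exact hij.le.trans (h k hk)
  · left; exact hij
  · right; left
    refine ⟨?_, hij⟩
    rcases h with h | h
    · intro k hk; exact hij.le.trans (h k hk)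
    · exact h

theorem XX_comm_low2 (e : Module.Basis (Fin d) F L) (i j : Fin d) (N : Fin d →₀ ℕ)
    (h : Low i N ∨ Low j N) :
    XX e i (XX e j (zz F N)) = XX e j (XX e i (zz F N)) + XL e ⁅e i, e j⁆ (zz F N) := by
  rcases XX_comm_low' i j N h with h | h | h
  · subst h; simp
  · exact XX_comm_low e i j N h.1 h.2
  · rw [XX_comm_low e j i N h.1 h.2, ← lie_skew (e i) (e j), map_neg, LinearMap.neg_apply]
    abel

theorem basis_ind (e : Module.Basis (Fin d) F L) (p : L → Prop) (h0 : p 0) (hb : ∀ i, p (e i))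
    (ha : ∀ x y, p x → p y → p (x + y)) (hs : ∀ (a : F) x, p x → p (a • x)) (x : L) : p x := by
  have hx : x ∈ Submodule.span F (Set.range e) := by rw [e.span_eq]; trivial
  induction hx using Submodule.span_induction with
  | mem x h => obtain ⟨i, rfl⟩ := h; exact hb i
  | zero => exact h0
  | add x y _ _ hx hy => exact ha x y hx hy
  | smul a x _ hx => exact hs a x hx

theorem XL_comm_of (e : Module.Basis (Fin d) F L) (v)
    (hv : ∀ i j, XX e i (XX e j v) = XX e j (XX e i v) + XL e ⁅e i, e j⁆ v) (x y : L) :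
    XL e x (XL e y v) = XL e y (XL e x v) + XL e ⁅x, y⁆ v := by
  refine basis_ind e (fun x => XL e x (XL e y v) = XL e y (XL e x v) + XL e ⁅x, y⁆ v)
    (by simp) (fun i => ?_) (fun x x' h h' => ?_) (fun a x h => ?_) x
  · refine basis_ind e (fun y => XL e (e i) (XL e y v) = XL e y (XL e (e i) v) + XL e ⁅e i, y⁆ v)
      (by simp) (fun j => ?_) (fun x x' h h' => ?_) (fun a x h => ?_) y
    · rw [XL_e, XL_e]; exact hv i j
    · simp only [map_add, LinearMap.add_apply, lie_add, h, h']; abel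
    · simp only [map_smul, LinearMap.smul_apply, lie_smul, h, smul_add]
  · simp only [map_add, LinearMap.add_apply, add_lie, h, h']; abel
  · simp only [map_smul, LinearMap.smul_apply, smul_lie, h, smul_add]

theorem XL_comm_zz (e : Module.Basis (Fin d) F L) (n : ℕ) : ∀ N : Fin d →₀ ℕ, N.degree = n →
    ∀ i j, XX e i (XX e j (zz F N)) = XX e j (XX e i (zz F N)) + XL e ⁅e i, e j⁆ (zz F N) := by
  induction n using Nat.strong_induction_on with
  | _ n ih =>
  intro N hN i j
  by_cases hl : Low i N ∨ Low j N
  · exact XX_comm_low2 e i j N hl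
  rw [not_or] at hl
  have hN0 : N ≠ 0 := by
    rintro rfl
    apply hl.1
    intro k hk
    simp at hk
  obtain ⟨k, Q, rfl, hk⟩ := exists_low N hN0
  rw [degree_add_dl] at hN
  have IH : ∀ v ∈ vf F d (Q.degree + 1), ∀ x y : L,
      XL e x (XL e y v) = XL e y (XL e x v) + XL e ⁅x, y⁆ v := by
    intro v hv x y
    refine XL_comm_of e v ?_ x y
    intro i j
    have : vf F d (Q.degree + 1) ≤ LinearMap.ker (XX e i ∘ₗ XX e j - (XX e j ∘ₗ XX e i + XL e ⁅e i, e j⁆)) := by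
      refine fil_le _ _ fun m hm => ?_
      rw [LinearMap.mem_ker, LinearMap.sub_apply, sub_eq_zero]
      exact ih m.degree (by omega) m rfl i j
    have := this hv
    rw [LinearMap.mem_ker, LinearMap.sub_apply, sub_eq_zero] at this
    exact this
  have hQ : zz F Q ∈ vf F d (Q.degree + 1) := mem_fil _ _ (by simp)
  have hlt : ∀ i, ¬ Low i (Q + dl k) → k ≤ i := by
    intro i hi
    by_contra hc
    rw [not_le] at hc
    exact hi (Low.add (fun t ht => hc.le.trans (hk t ht)) hc.le)
  have h2 : ∀ i j, k ≤ j → XX e i (XX e k (XX e j (zz F Q))) =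
      XX e k (XX e i (XX e j (zz F Q))) + XL e ⁅e i, e k⁆ (XX e j (zz F Q)) := by
    intro i j hkj
    have h3 := XX_comm_low2 e i k (Q + dl j) (Or.inr (hk.add hkj))
    have h4 := IH _ (XX_lead e j Q) (e i) (e k)
    rw [XL_e, XL_e] at h4
    simp only [map_sub] at h4
    rw [h3] at h4
    have h5 := sub_eq_iff_eq_add.1 h4
    rw [h5]
    abel
  have h6 : ∀ i j, k ≤ j → XX e i (XX e j (zz F (Q + dl k))) =
      XX e k (XX e i (XX e j (zz F Q))) + XL e ⁅e i, e k⁆ (XX e j (zz F Q)) +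
      XL e ⁅e j, e k⁆ (XX e i (zz F Q)) + XL e ⁅e i, ⁅e j, e k⁆⁆ (zz F Q) := by
    intro i j hkj
    rw [← XX_low e k Q hk, XX_comm_low2 e j k Q (Or.inr hk), map_add, h2 i j hkj]
    have := IH _ hQ (e i) ⁅e j, e k⁆
    rw [XL_e] at this
    rw [this]
    abel
  rw [h6 i j (hlt j hl.2), h6 j i (hlt i hl.1)]
  have h7 := IH _ hQ ⁅e i, e j⁆ (e k)
  rw [XL_e] at h7
  rw [← XX_low e k Q hk, h7]
  have h8 := IH _ hQ (e i) (e j)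
  rw [XL_e, XL_e] at h8
  rw [h8, map_add, lie_lie (e i) (e j) (e k), map_sub, LinearMap.sub_apply]
  abel

theorem XL_comm (e : Module.Basis (Fin d) F L) (x y : L) (v) :
    XL e x (XL e y v) = XL e y (XL e x v) + XL e ⁅x, y⁆ v := by
  refine XL_comm_of e v (fun i j => ?_) x y
  have : XX e i ∘ₗ XX e j = XX e j ∘ₗ XX e i + XL e ⁅e i, e j⁆ := by
    refine Finsupp.lhom_ext' fun m => LinearMap.ext_ring ?_
    exact XL_comm_zz e _ m rfl i j
  exact LinearMap.congr_fun this v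

attribute [local instance] LieRing.ofAssociativeRing

/-- the representation -/
noncomputable def rep (e : Module.Basis (Fin d) F L) :
    UniversalEnvelopingAlgebra F L →ₐ[F] Module.End F ((Fin d →₀ ℕ) →₀ F) :=
  UniversalEnvelopingAlgebra.lift F
    { XL e with
      map_lie' := by
        intro x y
        refine LinearMap.ext fun v => ?_
        have := XL_comm e x y v
        simp only [LieRing.of_associative_ring_bracket]
        change XL e ⁅x, y⁆ v = XL e x (XL e y v) - XL e y (XL e x v)
        rw [this]
        abel }

theorem rep_ι (e : Module.Basis (Fin d) F L) (x : L) :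
    rep e (UniversalEnvelopingAlgebra.ι F x) = XL e x := by
  rw [rep, UniversalEnvelopingAlgebra.lift_ι_apply]; rfl

/-- sorted monomials in the enveloping algebra -/
noncomputable def mono (e : Module.Basis (Fin d) F L) (m : Fin d →₀ ℕ) :
    UniversalEnvelopingAlgebra F L :=
  (((Finsupp.toMultiset m).sort (· ≤ ·)).map fun i => UniversalEnvelopingAlgebra.ι F (e i)).prod

theorem mono_zero (e : Module.Basis (Fin d) F L) : mono e 0 = 1 := by
  simp [mono]

theorem mono_low (e : Module.Basis (Fin d) F L) (i : Fin d) (m : Fin d →₀ ℕ) (h : Low i m) :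
    mono e (m + dl i) = UniversalEnvelopingAlgebra.ι F (e i) * mono e m := by
  have : Finsupp.toMultiset (m + dl i) = i ::ₘ Finsupp.toMultiset m := by
    rw [map_add, dl, Finsupp.toMultiset_single, add_comm]; simp
  rw [mono, this, Multiset.sort_cons, List.map_cons, List.prod_cons, mono]
  intro b hb
  exact h b ((Finsupp.mem_toMultiset m b).1 hb)

/-- evaluation of sorted monomials -/
noncomputable def ev (e : Module.Basis (Fin d) F L) :
    ((Fin d →₀ ℕ) →₀ F) →ₗ[F] UniversalEnvelopingAlgebra F L :=
  Finsupp.linearCombination F (mono e)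

theorem ev_zz (e : Module.Basis (Fin d) F L) (m : Fin d →₀ ℕ) : ev e (zz F m) = mono e m := by
  rw [ev, zz, Finsupp.linearCombination_single, one_smul]

theorem ev_XX_zz (e : Module.Basis (Fin d) F L) (n : ℕ) : ∀ m : Fin d →₀ ℕ, m.degree = n → ∀ i,
    ev e (XX e i (zz F m)) = UniversalEnvelopingAlgebra.ι F (e i) * mono e m := by
  induction n using Nat.strong_induction_on with
  | _ n ih =>
  intro m hm i
  by_cases hl : Low i m
  · rw [XX_low e i m hl, ev_zz, mono_low e i m hl]
  have hm0 : m ≠ 0 := by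
    rintro rfl
    apply hl
    intro k hk
    simp at hk
  obtain ⟨j, Q, rfl, hj⟩ := exists_low m hm0
  rw [degree_add_dl] at hm
  have hji : j ≤ i := by
    by_contra hc
    rw [not_le] at hc
    exact hl (Low.add (fun t ht => hc.le.trans (hj t ht)) hc.le)
  have IH : ∀ v ∈ vf F d (Q.degree + 1), ∀ k,
      ev e (XX e k v) = UniversalEnvelopingAlgebra.ι F (e k) * ev e v := by
    intro v hv k
    have : vf F d (Q.degree + 1) ≤ LinearMap.ker (ev e ∘ₗ XX e k -
        LinearMap.mulLeft F (UniversalEnvelopingAlgebra.ι F (e k)) ∘ₗ ev e) := by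
      refine fil_le _ _ fun m hm => ?_
      rw [LinearMap.mem_ker, LinearMap.sub_apply, sub_eq_zero]
      simp only [LinearMap.comp_apply, LinearMap.mulLeft_apply, ev_zz]
      exact ih m.degree (by omega) m rfl k
    have := this hv
    rw [LinearMap.mem_ker, LinearMap.sub_apply, sub_eq_zero] at this
    exact this
  have hQ : zz F Q ∈ vf F d (Q.degree + 1) := mem_fil _ _ (by simp)
  have IHL : ∀ y, ev e (XL e y (zz F Q)) = UniversalEnvelopingAlgebra.ι F y * mono e Q := by
    intro y
    refine basis_ind e (fun y => ev e (XL e y (zz F Q)) = UniversalEnvelopingAlgebra.ι F y * mono e Q)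
      (by simp) (fun k => ?_) (fun x x' h h' => ?_) (fun a x h => ?_) y
    · rw [XL_e, IH _ hQ, ev_zz]
    · simp only [map_add, LinearMap.add_apply, h, h', add_mul]
    · simp only [map_smul, LinearMap.smul_apply, h, smul_mul_assoc]
  have h1 : ev e (XX e j (XX e i (zz F Q))) =
      UniversalEnvelopingAlgebra.ι F (e j) * ev e (XX e i (zz F Q)) := by
    have h2 := IH _ (XX_lead e i Q) j
    rw [map_sub, map_sub, map_sub, mul_sub, XX_low e j (Q + dl i) (hj.add hji), ev_zz, ev_zz,
      mono_low e j _ (hj.add hji)] at h2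
    exact sub_left_injective h2
  rw [← XX_low e j Q hj, XX_comm_low2 e i j Q (Or.inr hj), map_add, h1, IHL, IH _ hQ, ev_zz,
    mono_low e j Q hj, LieHom.map_lie, LieRing.of_associative_ring_bracket, sub_mul]
  simp only [mul_assoc]
  abel

theorem uea_ind (p : UniversalEnvelopingAlgebra F L → Prop)
    (h1 : ∀ a, p (algebraMap F _ a)) (hι : ∀ x, p (UniversalEnvelopingAlgebra.ι F x))
    (ha : ∀ a b, p a → p b → p (a + b)) (hm : ∀ a b, p a → p b → p (a * b)) (u) : p u := by
  obtain ⟨t, rfl⟩ : ∃ t, UniversalEnvelopingAlgebra.mkAlgHom F L t = u := RingCon.mk'_surjective _ u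
  induction t using TensorAlgebra.induction with
  | algebraMap r => simpa using h1 r
  | ι x => simpa using hι x
  | mul a b ha hb => simpa using hm _ _ ha hb
  | add a b ha' hb => simpa using ha _ _ ha' hb

theorem ev_rep (e : Module.Basis (Fin d) F L) (u : UniversalEnvelopingAlgebra F L) :
    ∀ v, ev e (rep e u v) = u * ev e v := by
  refine uea_ind (fun u => ∀ v, ev e (rep e u v) = u * ev e v) (fun a v => ?_) (fun x v => ?_)
    (fun a b ha hb v => ?_) (fun a b ha hb v => ?_) u
  · rw [AlgHom.commutes, ← Algebra.smul_def]; simp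
  · rw [rep_ι]
    refine basis_ind e (fun x => ev e (XL e x v) = UniversalEnvelopingAlgebra.ι F x * ev e v)
      (by simp) (fun i => ?_) (fun x x' h h' => ?_) (fun a x h => ?_) x
    · rw [XL_e]
      have : ev e ∘ₗ XX e i =
          LinearMap.mulLeft F (UniversalEnvelopingAlgebra.ι F (e i)) ∘ₗ ev e := by
        refine Finsupp.lhom_ext' fun m => LinearMap.ext_ring ?_
        have := ev_XX_zz e _ m rfl i
        rw [← ev_zz] at this
        exact this
      exact LinearMap.congr_fun this v
    · simp only [map_add, LinearMap.add_apply, h, h', add_mul]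
    · simp only [map_smul, LinearMap.smul_apply, h, smul_mul_assoc]
  · simp only [map_add, LinearMap.add_apply, ha, hb, add_mul]
  · rw [map_mul, Module.End.mul_apply, ha, hb, mul_assoc]

theorem mono_ind (p : (Fin d →₀ ℕ) → Prop) (h0 : p 0) (h : ∀ j N, Low j N → p N → p (N + dl j))
    (m : Fin d →₀ ℕ) : p m := by
  induction hn : m.degree generalizing m with
  | zero =>
    have : m = 0 := (Finsupp.degree_eq_zero_iff m).1 hn
    rw [this]; exact h0
  | succ n ih =>
    have hm0 : m ≠ 0 := by rintro rfl; simp at hn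
    obtain ⟨j, Q, rfl, hj⟩ := exists_low m hm0
    rw [degree_add_dl] at hn
    exact h j Q hj (ih Q (by omega))

theorem rep_mono (e : Module.Basis (Fin d) F L) (m : Fin d →₀ ℕ) :
    rep e (mono e m) (zz F 0) = zz F m := by
  refine mono_ind (fun m => rep e (mono e m) (zz F 0) = zz F m) ?_ (fun j N hj h => ?_) m
  · rw [mono_zero]; simp
  · rw [mono_low e j N hj, map_mul, Module.End.mul_apply, h, rep_ι, XL_e, XX_low e j N hj]

/-- The Poincaré–Birkhoff–Witt linear isomorphism. -/
noncomputable def pbwEquiv (e : Module.Basis (Fin d) F L) :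
    UniversalEnvelopingAlgebra F L ≃ₗ[F] ((Fin d →₀ ℕ) →₀ F) :=
  LinearEquiv.ofLinearMap ((LinearMap.applyₗ (zz F 0)).comp (rep e).toLinearMap) (ev e)
    (by
      refine Finsupp.lhom_ext' fun m => LinearMap.ext_ring ?_
      have := rep_mono e m
      rw [← ev_zz] at this
      exact this)
    (by
      refine LinearMap.ext fun u => ?_
      have := ev_rep e u (zz F 0)
      rw [ev_zz, mono_zero, mul_one] at this
      exact this)

/-- The Poincaré–Birkhoff–Witt basis. -/
noncomputable def pbw (e : Module.Basis (Fin d) F L) :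
    Module.Basis (Fin d →₀ ℕ) F (UniversalEnvelopingAlgebra F L) := ⟨pbwEquiv e⟩

theorem pbw_apply (e : Module.Basis (Fin d) F L) (m) : pbw e m = mono e m := ev_zz e m

theorem pbw_dl (e : Module.Basis (Fin d) F L) (i) :
    pbw e (dl i) = UniversalEnvelopingAlgebra.ι F (e i) := by
  have := mono_low e i 0 (fun k hk => by simp at hk)
  rw [zero_add, mono_zero, mul_one] at this
  rw [pbw_apply, this]

theorem pbw_ι_mul (e : Module.Basis (Fin d) F L) (i : Fin d) (m) :
    UniversalEnvelopingAlgebra.ι F (e i) * pbw e m - pbw e (m + dl i) ∈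
      fil (F := F) (pbw e) (fun m => m.degree) (m.degree + 1) := by
  have h := XX_lead e i m
  have h2 : vf F d (m.degree + 1) ≤
      (fil (F := F) (pbw e) (fun m => m.degree) (m.degree + 1)).comap (ev e) := by
    refine fil_le _ _ fun m' hm' => ?_
    rw [Submodule.mem_comap, ev_zz, ← pbw_apply]
    exact mem_fil (pbw e) _ hm'
  have h3 := h2 h
  rw [Submodule.mem_comap, map_sub, ev_XX_zz e _ m rfl, ev_zz, ← pbw_apply, ← pbw_apply] at h3
  exact h3

theorem pbw_mul (e : Module.Basis (Fin d) F L) (m n) :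
    pbw e m * pbw e n - pbw e (m + n) ∈
      fil (F := F) (pbw e) (fun m => m.degree) (m.degree + n.degree) := by
  refine mono_ind (fun m => pbw e m * pbw e n - pbw e (m + n) ∈
      fil (F := F) (pbw e) (fun m => m.degree) (m.degree + n.degree)) ?_ (fun j N hj h => ?_) m
  · rw [pbw_apply, mono_zero, one_mul, zero_add, sub_self]; exact zero_mem _
  · have h1 := pbw_ι_mul e j (N + n)
    have h2 : fil (F := F) (pbw e) (fun m => m.degree) (N.degree + n.degree) ≤
      (fil (F := F) (pbw e) (fun m => m.degree) (N.degree + n.degree + 1)).comap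
        (LinearMap.mulLeft F (UniversalEnvelopingAlgebra.ι F (e j))) := by
      refine fil_le _ _ fun m' hm' => ?_
      rw [Submodule.mem_comap, LinearMap.mulLeft_apply]
      have h3 := fil_mono (F := F) (pbw e) _
        (by omega : m'.degree + 1 ≤ N.degree + n.degree + 1) (pbw_ι_mul e j m')
      have h4 : pbw e (m' + dl j) ∈ 
        fil (F := F) (pbw e) (fun m => m.degree) (N.degree + n.degree + 1) :=
        mem_fil (pbw e) _ (by rw [degree_add_dl]; omega)
      simpa using add_mem h3 h4
    have h5 := h2 h
    rw [Submodule.mem_comap, LinearMap.mulLeft_apply, mul_sub] at h5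
    rw [map_add] at h1
    rw [degree_add_dl, pbw_apply, mono_low e j N hj, ← pbw_apply, mul_assoc,
      add_right_comm N (dl j) n, add_right_comm N.degree 1]
    simpa using add_mem h5 h1
end PBW

theorem bridge (F : Type u) [Field F] (R : Type u) [Ring R] [Algebra F R]
    (X M : ModuleCat.{u} R) (k : ℕ) :
    Subsingleton (ExtGrp F R X M (k+1)) ↔ Subsingleton (Abelian.Ext.{u} X M (k+1)) := by
  let P := ProjectiveResolution.of X
  have h1 : Subsingleton (ExtGrp F R X M (k+1)) ↔
      ∀ f : P.complex.X (k+1) ⟶ M, P.complex.d (k+2) (k+1) ≫ f = 0 →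
        ∃ g : P.complex.X k ⟶ M, P.complex.d (k+1) k ≫ g = f := by
    rw [← ModuleCat.isZero_iff_subsingleton, ExtGrp, (P.isoExt (k+1) M).isZero_iff,
      ← HomologicalComplex.exactAt_iff_isZero_homology,
      HomologicalComplex.exactAt_iff' _ k (k+1) (k+2) (by simp) (by simp),
      ShortComplex.moduleCat_exact_iff]
    rfl
  have h2 : Subsingleton (Abelian.Ext.{u} X M (k+1)) ↔
      ∀ f : P.complex.X (k+1) ⟶ M, P.complex.d (k+2) (k+1) ≫ f = 0 →
        ∃ g : P.complex.X k ⟶ M, P.complex.d (k+1) k ≫ g = f := by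
    constructor
    · intro h f hf
      exact (P.extMk_eq_zero_iff f (k+2) rfl hf k rfl).1 (Subsingleton.elim _ _)
    · intro h
      refine subsingleton_of_forall_eq 0 fun e => ?_
      obtain ⟨f, hf, rfl⟩ := P.extMk_surjective e (k+2) rfl
      exact (P.extMk_eq_zero_iff f (k+2) rfl hf k rfl).2 (h f hf)
  rw [h1, h2]

/-- multiplication by a central element -/
def czHom (R : Type u) [Ring R] (w : R) (hw : ∀ r, w * r = r * w) (X : Type u) [AddCommGroup X]
    [Module R X] : X →ₗ[R] X where
  toFun x := w • x
  map_add' := by simp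
  map_smul' r x := by simp [smul_smul, hw]

theorem cz_comp (R : Type u) [Ring R] (w : R) (hw : ∀ r, w * r = r * w) (X S : ModuleCat.{u} R)
    (n : ℕ) (e : Abelian.Ext.{u} X S n) (hS : ∀ s : S, w • s = 0) :
    (Abelian.Ext.mk₀ (ModuleCat.ofHom (czHom R w hw X))).comp e (zero_add _) = 0 := by
  let P := ProjectiveResolution.of X
  obtain ⟨f, hf, rfl⟩ := P.extMk_surjective e (n+1) rfl
  let φ : ProjectiveResolution.Hom P P (ModuleCat.ofHom (czHom R w hw X)) :=
    { hom := { f := fun i => ModuleCat.ofHom (czHom R w hw (P.complex.X i))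
               comm' := by intro i j _; ext x; simp [czHom] }
      hom_f_zero_comp_π_f_zero := by ext x; exact (P.π.f 0).hom.map_smul w x }
  rw [ProjectiveResolution.mk₀_comp_extMk f _ rfl hf φ]
  have : φ.hom.f n ≫ f = 0 := by
    ext x
    simp [φ, czHom, hS]
  simp [this]

theorem ext_ne_step (R : Type u) [Ring R] (w : R) (hw : ∀ r, w * r = r * w)
    (S : ModuleCat.{u} R) (hS : ∀ s : S, w • s = 0)
    (X X' : Type u) [AddCommGroup X] [Module R X] [AddCommGroup X'] [Module R X']
    (hinj : ∀ x : X, w • x = 0 → x = 0) (g : X →ₗ[R] X') (hg : Function.Surjective g)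
    (hker : ∀ x, g x = 0 ↔ ∃ y, w • y = x) (n : ℕ)
    (h : Nontrivial (Abelian.Ext.{u} (ModuleCat.of R X) S n)) :
    Nontrivial (Abelian.Ext.{u} (ModuleCat.of R X') S (n+1)) := by
  let T : ShortComplex (ModuleCat.{u} R) := ShortComplex.mk
    (ModuleCat.ofHom (czHom R w hw X)) (ModuleCat.ofHom g) (by
      ext x
      exact (hker (w • x)).2 ⟨x, rfl⟩)
  have hT : T.ShortExact := by
    refine { exact := ?_, mono_f := ?_, epi_g := ?_ }
    · rw [ShortComplex.moduleCat_exact_iff]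
      intro x hx
      obtain ⟨y, hy⟩ := (hker x).1 hx
      exact ⟨y, hy⟩
    · rw [ModuleCat.mono_iff_injective]
      refine (injective_iff_map_eq_zero (czHom R w hw X)).2 hinj
    · rw [ModuleCat.epi_iff_surjective]
      exact hg
  obtain ⟨e, he⟩ := exists_ne (0 : Abelian.Ext.{u} (ModuleCat.of R X) S n)
  refine ⟨⟨hT.extClass.comp e (add_comm 1 n), 0, fun h0 => he ?_⟩⟩
  obtain ⟨x2, hx2⟩ := Abelian.Ext.contravariant_sequence_exact₁ hT S e _ h0
  rw [← hx2]
  exact cz_comp R w hw (ModuleCat.of R X) S n x2 hS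

theorem ext_zero_ne (R : Type u) [Ring R] (S : Type u) [AddCommGroup S] [Module R S]
    [Nontrivial S] : Nontrivial (Abelian.Ext.{u} (ModuleCat.of R R) (ModuleCat.of R S) 0) := by
  obtain ⟨s, hs⟩ := exists_ne (0 : S)
  have : Nontrivial (ModuleCat.of R R ⟶ ModuleCat.of R S) := by
    refine ⟨⟨ModuleCat.ofHom (LinearMap.toSpanSingleton R S s), 0, fun h => hs ?_⟩⟩
    have := congrArg (fun f => f.hom (1:R)) h
    simpa using this
  exact Abelian.Ext.addEquiv₀.toEquiv.nontrivial

theorem ext_quot_ne (R : Type u) [Ring R] (X : ModuleCat.{u} R) (M S : Type u) [AddCommGroup M]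
    [Module R M] [AddCommGroup S] [Module R S] (g : M →ₗ[R] S) (hg : Function.Surjective g) (n : ℕ)
    [HasProjectiveDimensionLT X (n+1)]
    (h : Nontrivial (Abelian.Ext.{u} X (ModuleCat.of R S) n)) :
    Nontrivial (Abelian.Ext.{u} X (ModuleCat.of R M) n) := by
  let T : ShortComplex (ModuleCat.{u} R) := ShortComplex.mk
    (ModuleCat.ofHom (LinearMap.ker g).subtype) (ModuleCat.ofHom g) (by
      ext x; simp)
  have hT : T.ShortExact := by
    refine { exact := ?_, mono_f := ?_, epi_g := ?_ }
    · rw [ShortComplex.moduleCat_exact_iff]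
      intro x hx
      exact ⟨⟨x, hx⟩, rfl⟩
    · rw [ModuleCat.mono_iff_injective]
      exact Subtype.val_injective
    · rw [ModuleCat.epi_iff_surjective]
      exact hg
  by_contra hc
  rw [not_nontrivial_iff_subsingleton] at hc
  obtain ⟨e, he⟩ := exists_ne (0 : Abelian.Ext.{u} X (ModuleCat.of R S) n)
  obtain ⟨x2, hx2⟩ := Abelian.Ext.covariant_sequence_exact₃ X hT e rfl
    (Abelian.Ext.eq_zero_of_hasProjectiveDimensionLT _ (n+1) le_rfl)
  apply he
  rw [← hx2, Subsingleton.elim (h := hc) x2 0, Abelian.Ext.zero_comp]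

theorem pd_step (R : Type u) [Ring R] (P Y : Type u) [AddCommGroup P] [Module R P]
    [Module.Projective R P] [AddCommGroup Y] [Module R Y] (g : P →ₗ[R] Y)
    (hg : Function.Surjective g) (n : ℕ)
    (h : HasProjectiveDimensionLT (ModuleCat.of R (LinearMap.ker g)) n) :
    HasProjectiveDimensionLT (ModuleCat.of R Y) (n+1) := by
  let T : ShortComplex (ModuleCat.{u} R) := ShortComplex.mk
    (ModuleCat.ofHom (LinearMap.ker g).subtype) (ModuleCat.ofHom g) (by
      ext x; simp)
  have hT : T.ShortExact := by
    refine { exact := ?_, mono_f := ?_, epi_g := ?_ }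
    · rw [ShortComplex.moduleCat_exact_iff]
      intro x hx
      exact ⟨⟨x, hx⟩, rfl⟩
    · rw [ModuleCat.mono_iff_injective]
      exact Subtype.val_injective
    · rw [ModuleCat.epi_iff_surjective]
      exact hg
  have : Projective (ModuleCat.of R P) := (IsProjective.iff_projective P).1 inferInstance
  exact hT.hasProjectiveDimensionLT_X₃ n h
    (hasProjectiveDimensionLT_of_ge (ModuleCat.of R P) 1 (n+1) (by omega))

section GB
variable {F : Type u} [Field F] {U : Type u} [Ring U] [Algebra F U] {d : ℕ}
  (b : Module.Basis (Fin d →₀ ℕ) F U)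

/-- The multiplication of `U` is commutative up to lower order terms, with leading terms given
by addition of exponents. -/
structure PBWAlg (b : Module.Basis (Fin d →₀ ℕ) F U) : Prop where
  one : b 0 = 1
  mul : ∀ m n, b m * b n - b (m + n) ∈ fil (F := F) b (fun m => m.degree) (m.degree + n.degree)

/-- all letters of `m` are smaller than `j` -/
def SupLT (j : ℕ) (m : Fin d →₀ ℕ) : Prop := ∀ k ∈ m.support, k.val < j

theorem SupLT.add {j : ℕ} {m n : Fin d →₀ ℕ} (h : SupLT j m) (h' : SupLT j n) :
    SupLT j (m + n) := by
  classical
  intro k hk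
  rcases Finset.mem_union.1 (Finsupp.support_add hk) with h1 | h1
  · exact h k h1
  · exact h' k h1

theorem SupLT.mono {j j' : ℕ} {m : Fin d →₀ ℕ} (h : SupLT j m) (h' : j ≤ j') : SupLT j' m :=
  fun k hk => lt_of_lt_of_le (h k hk) h'

theorem supLT_dl {j : ℕ} {i : Fin d} (h : i.val < j) : SupLT j (dl i) := by
  intro k hk
  have := Finsupp.support_single_subset hk
  simp only [Finset.mem_singleton] at this
  rw [this]; exact h

theorem mem_support_add_dl (m : Fin d →₀ ℕ) (i : Fin d) : i ∈ (m + dl i).support := by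
  rw [Finsupp.mem_support_iff]; simp [dl]

theorem exists_high {j : ℕ} {m : Fin d →₀ ℕ} (h : ¬ SupLT j m) :
    ∃ (i : Fin d) (m' : Fin d →₀ ℕ), m = m' + dl i ∧ SupLT (i.val+1) m' ∧ j ≤ i.val := by
  have hne : m.support.Nonempty := by
    by_contra hc
    rw [Finset.not_nonempty_iff_eq_empty] at hc
    apply h
    intro k hk
    simp [hc] at hk
  refine ⟨m.support.max' hne, m - dl (m.support.max' hne), ?_, ?_, ?_⟩
  · have h1 := m.support.max'_mem hne
    rw [tsub_add_cancel_of_le]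
    rw [dl, Finsupp.single_le_iff]
    have := Finsupp.mem_support_iff.1 h1
    omega
  · intro k hk
    have : k ≤ m.support.max' hne := by
      refine Finset.le_max' _ _ ?_
      rw [Finsupp.mem_support_iff] at hk ⊢
      rw [Finsupp.tsub_apply] at hk
      omega
    exact Nat.lt_succ_of_le this
  · by_contra hc
    apply h
    intro k hk
    have : k ≤ m.support.max' hne := Finset.le_max' _ _ hk
    have : k.val ≤ (m.support.max' hne).val := this
    omega

theorem high_unique {i i' : Fin d} {m m' : Fin d →₀ ℕ} (h : m + dl i = m' + dl i')
    (hm : SupLT (i.val+1) m) (hm' : SupLT (i'.val+1) m') : i = i' ∧ m = m' := by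
  have h1 : i'.val < i.val + 1 := by
    refine (hm.add (supLT_dl (Nat.lt_succ_self _))) i' ?_
    rw [h]; exact mem_support_add_dl _ _
  have h2 : i.val < i'.val + 1 := by
    refine (hm'.add (supLT_dl (Nat.lt_succ_self _))) i ?_
    rw [← h]; exact mem_support_add_dl _ _
  have : i = i' := Fin.ext (by omega)
  subst this
  exact ⟨rfl, add_right_cancel h⟩

variable {A : Type u}

/-- The `F`-basis of a free module. -/
noncomputable def fb (A : Type u) : Module.Basis (Σ _ : A, (Fin d →₀ ℕ)) F (A →₀ U) :=
  Finsupp.basis (fun _ => b)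

theorem fb_apply (x : Σ _ : A, (Fin d →₀ ℕ)) : fb b A x = Finsupp.single x.1 (b x.2) := by
  simp [fb]

/-- degree -/
noncomputable def pdg (D : A → ℕ) (x : Σ _ : A, (Fin d →₀ ℕ)) : ℕ := x.2.degree + D x.1

/-- filtration of a free module -/
noncomputable abbrev Pf (D : A → ℕ) (n : ℕ) : Submodule F (A →₀ U) := fil (fb b A) (pdg D) n

/-- special subspaces: lower order terms plus top order terms with small letters -/
noncomputable def Tt (D l : A → ℕ) (n j : ℕ) : Submodule F (A →₀ U) :=
  Submodule.span F (fb b A '' {x | pdg D x < n ∨ (pdg D x = n ∧ SupLT (j+1) x.2 ∧ j < l x.1)})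

/-- lower order terms plus normal top order terms -/
noncomputable def Nn (D l : A → ℕ) (n : ℕ) : Submodule F (A →₀ U) :=
  Submodule.span F (fb b A '' {x | pdg D x < n ∨ (pdg D x = n ∧ SupLT (l x.1) x.2)})

/-- normal elements -/
noncomputable def NN (l : A → ℕ) : Submodule F (A →₀ U) :=
  Submodule.span F (fb b A '' {x | SupLT (l x.1) x.2})

theorem Pf_le_Tt (D l : A → ℕ) (n j : ℕ) : Pf b D n ≤ Tt b D l n j :=
  Submodule.span_mono (Set.image_mono fun _ hx => Or.inl hx)

theorem Pf_le_Nn (D l : A → ℕ) (n : ℕ) : Pf b D n ≤ Nn b D l n :=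
  Submodule.span_mono (Set.image_mono fun _ hx => Or.inl hx)

theorem Tt_le_Nn (D l : A → ℕ) (n j : ℕ) : Tt b D l n j ≤ Nn b D l n := by
  refine Submodule.span_mono (Set.image_mono fun x hx => ?_)
  rcases hx with hx | ⟨h1, h2, h3⟩
  · exact Or.inl hx
  · exact Or.inr ⟨h1, h2.mono (by omega)⟩

variable {b}

theorem PBWAlg.smul_fb (hb : PBWAlg b) (D : A → ℕ) (m k : Fin d →₀ ℕ) (a : A) :
    b m • fb b A ⟨a, k⟩ - fb b A ⟨a, m + k⟩ ∈ Pf b D (m.degree + k.degree + D a) := by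
  have h := hb.mul m k
  have h2 : fil (F := F) b (fun m => m.degree) (m.degree + k.degree) ≤
      (Pf b D (m.degree + k.degree + D a)).comap (Finsupp.lsingle a) := by
    refine fil_le _ _ fun n hn => ?_
    rw [Submodule.mem_comap, Finsupp.lsingle_apply]
    have := mem_fil (F := F) (fb b A) (pdg D) (n := m.degree + k.degree + D a) (i := ⟨a, n⟩)
      (by simp only [pdg]; omega)
    rwa [fb_apply] at this
  have := h2 h
  rw [Submodule.mem_comap, Finsupp.lsingle_apply, Finsupp.single_sub] at this
  rw [fb_apply, fb_apply, Finsupp.smul_single, smul_eq_mul]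
  exact this

theorem PBWAlg.smul_Pf (hb : PBWAlg b) (D : A → ℕ) (m : Fin d →₀ ℕ) (n : ℕ) (v : A →₀ U)
    (hv : v ∈ Pf b D n) : b m • v ∈ Pf b D (n + m.degree) := by
  have : Pf b D n ≤ (Pf b D (n + m.degree)).comap (Module.toModuleEnd F (A →₀ U) (b m)) := by
    refine fil_le _ _ fun ⟨a, k⟩ hx => ?_
    rw [Submodule.mem_comap, Module.toModuleEnd_apply, DistribSMul.toLinearMap_apply]
    simp only [pdg] at hx
    have h1 := fil_mono (F := F) (fb b A) (pdg D) (by omega : m.degree + k.degree + D a ≤ n + m.degree)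
      (hb.smul_fb D m k a)
    have h2 := mem_fil (F := F) (fb b A) (pdg D) (n := n + m.degree) (i := ⟨a, m + k⟩)
      (by simp only [pdg, map_add]; omega)
    simpa using add_mem h1 h2
  exact this hv

theorem PBWAlg.smul_Tt (hb : PBWAlg b) (D l : A → ℕ) (m : Fin d →₀ ℕ) (n j : ℕ)
    (hm : SupLT (j+1) m) (v : A →₀ U) (hv : v ∈ Tt b D l n j) :
    b m • v ∈ Tt b D l (n + m.degree) j := by
  have : Tt b D l n j ≤
      (Tt b D l (n + m.degree) j).comap (Module.toModuleEnd F (A →₀ U) (b m)) := by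
    rw [Tt, Submodule.span_le]
    rintro _ ⟨⟨a, k⟩, hx, rfl⟩
    rw [SetLike.mem_coe, Submodule.mem_comap, Module.toModuleEnd_apply,
      DistribSMul.toLinearMap_apply]
    rcases hx with hx | ⟨h1, h2, h3⟩
    · exact Pf_le_Tt b D l _ j (hb.smul_Pf D m n _ (mem_fil _ _ hx))
    · simp only [pdg] at h1 h2 h3
      have h4 := Pf_le_Tt b D l _ j (fil_mono (F := F) (fb b A) (pdg D)
        (by omega : m.degree + k.degree + D a ≤ n + m.degree) (hb.smul_fb D m k a))
      have h5 : fb b A ⟨a, m + k⟩ ∈ Tt b D l (n + m.degree) j := by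
        refine Submodule.subset_span ⟨_, Or.inr ⟨?_, hm.add h2, h3⟩, rfl⟩
        simp only [pdg, map_add]; omega
      simpa using add_mem h4 h5
  exact this hv

/-- A Gröbner presentation of a module. -/
structure GData (b : Module.Basis (Fin d →₀ ℕ) F U) (D l : A → ℕ) {Y : Type u} [AddCommGroup Y]
    [Module U Y] (y : A → Y) : Prop where
  inj : ∀ v ∈ NN b l, Finsupp.linearCombination U y v = 0 → v = 0
  rel : ∀ a (j : Fin d), l a ≤ j.val → ∃ t ∈ Tt b D l (D a + 1) j.val,
    b (dl j) • y a = Finsupp.linearCombination U y t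
  surj : Function.Surjective (Finsupp.linearCombination U y)

/-- index set of the syzygies -/
abbrev Syz (d : ℕ) (l : A → ℕ) : Type u := {x : A × Fin d // l x.1 ≤ x.2.val}

theorem GData.step (hb : PBWAlg b) {D l : A → ℕ} {Y : Type u} [AddCommGroup Y]
    [Module U Y] {y : A → Y} (h : GData b D l y) :
    ∃ y' : Syz d l → LinearMap.ker (Finsupp.linearCombination U y),
      GData b (fun x => D x.1.1 + 1) (fun x => x.1.2.val + 1) y' := by
  classical
  obtain ⟨inj, rel, surj⟩ := h
  set π := Finsupp.linearCombination U y with hπ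
  choose t ht hty using rel
  let r : Syz d l → (A →₀ U) := fun x => fb b A ⟨x.1.1, dl x.1.2⟩ - t x.1.1 x.1.2 x.2
  have hr : ∀ x, π (r x) = 0 := by
    intro x
    simp only [r]
    rw [map_sub, ← hty, fb_apply, hπ, Finsupp.linearCombination_single, sub_self]
  let ρ : (Syz d l →₀ U) →ₗ[U] (A →₀ U) := Finsupp.linearCombination U r
  let ρF : (Syz d l →₀ U) →ₗ[F] (A →₀ U) := ρ.restrictScalars F
  have hρ : ∀ x m, ρ (fb b (Syz d l) ⟨x, m⟩) = b m • r x := by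
    intro x m
    simp only [ρ, fb_apply, Finsupp.linearCombination_single]
  have hρk : ∀ v, π (ρ v) = 0 := by
    intro v
    have : π ∘ₗ ρ = 0 := by
      refine Finsupp.lhom_ext' fun x => LinearMap.ext_ring ?_
      simp [ρ, hr]
    exact LinearMap.congr_fun this v
  -- leading terms
  have hlead : ∀ (x : Syz d l) (m : Fin d →₀ ℕ), SupLT (x.1.2.val+1) m →
      b m • r x - fb b A ⟨x.1.1, m + dl x.1.2⟩ ∈
        Tt b D l (m.degree + D x.1.1 + 1) x.1.2.val := by
    intro x m hm
    have h1 := Pf_le_Tt b D l _ x.1.2.val (hb.smul_fb D m (dl x.1.2) x.1.1)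
    have h2 := hb.smul_Tt D l m _ _ hm _ (ht x.1.1 x.1.2 x.2)
    have e1 : m.degree + (dl x.1.2).degree + D x.1.1 = m.degree + D x.1.1 + 1 := by
      simp [dl]; omega
    have e2 : D x.1.1 + 1 + m.degree = m.degree + D x.1.1 + 1 := by omega
    rw [e1] at h1
    rw [e2] at h2
    have := sub_mem h1 h2
    simp only [r, smul_sub]
    convert this using 1
    abel
  -- triangular basis
  let c : (Σ _ : A, (Fin d →₀ ℕ)) → (A →₀ U) := fun x =>
    if hx : SupLT (l x.1) x.2 then fb b A x
    else b (exists_high hx).choose_spec.choose •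
      r ⟨(x.1, (exists_high hx).choose), (exists_high hx).choose_spec.choose_spec.2.2⟩
  have hc1 : ∀ x, SupLT (l x.1) x.2 → c x = fb b A x := fun x hx => by
    simp only [c, dif_pos hx]
  have hc2 : ∀ (x : Syz d l) (m : Fin d →₀ ℕ), SupLT (x.1.2.val+1) m →
      c ⟨x.1.1, m + dl x.1.2⟩ = b m • r x := by
    rintro ⟨⟨a, j⟩, hj⟩ m hm
    have hx : ¬ SupLT (l a) (m + dl j) := by
      intro hc
      have := hc j (mem_support_add_dl _ _)
      simp only at hj
      omega
    obtain ⟨h1, h2⟩ := high_unique (exists_high hx).choose_spec.choose_spec.1 hm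
      (exists_high hx).choose_spec.choose_spec.2.1
    simp only [c, dif_neg hx]
    simp only [← h2]
    congr 2
    simp only [← h1]
  have hcex : ∀ x : (Σ _ : A, (Fin d →₀ ℕ)), ¬ SupLT (l x.1) x.2 → ∃ (x' : Syz d l) (m : Fin d →₀ ℕ),
      SupLT (x'.1.2.val+1) m ∧ x = ⟨x'.1.1, m + dl x'.1.2⟩ := by
    rintro ⟨a, m⟩ hx
    obtain ⟨i, m', rfl, h1, h2⟩ := exists_high hx
    exact ⟨⟨(a, i), h2⟩, m', h1, rfl⟩
  let deg2 : (Σ _ : A, (Fin d →₀ ℕ)) → ℕ := fun x =>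
    2 * pdg D x + if SupLT (l x.1) x.2 then 0 else 1
  have hNn : ∀ n, Nn b D l n ≤ fil (fb b A) deg2 (2 * n + 1) := by
    intro n
    refine Submodule.span_mono (Set.image_mono fun x hx => ?_)
    simp only [Set.mem_ofPred_eq, deg2]
    rcases hx with hx | hx
    · split_ifs <;> omega
    · rw [if_pos hx.2, hx.1]; omega
  have htri : ∀ x, c x - fb b A x ∈ fil (F := F) (fb b A) deg2 (deg2 x) := by
    intro x
    by_cases hx : SupLT (l x.1) x.2
    · rw [hc1 x hx, sub_self]; exact zero_mem _
    · have : deg2 x = 2 * pdg D x + 1 := by simp only [deg2, if_neg hx]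
      rw [this]
      obtain ⟨x', m, hm, rfl⟩ := hcex x hx
      rw [hc2 x' m hm]
      apply hNn
      apply Tt_le_Nn
      have := hlead x' m hm
      have e : pdg D ⟨x'.1.1, m + dl x'.1.2⟩ = m.degree + D x'.1.1 + 1 := by
        simp only [pdg, degree_add_dl]; omega
      rw [e]
      exact this
  have hind : LinearIndependent F c := tri_indep (fb b A) deg2 c htri
  have hspan := tri_span (F := F) (fb b A) deg2 c htri
  let D' : Syz d l → ℕ := fun x => D x.1.1 + 1
  let l' : Syz d l → ℕ := fun x => x.1.2.val + 1
  have R2 : ∀ n, ∀ v ∈ Pf b D n, ∃ ν ∈ NN b l, ∃ t' ∈ Pf b D' n, v = ν + ρ t' := by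
    intro n v hv
    have hv2 : v ∈ fil (F := F) (fb b A) deg2 (2 * n) := by
      refine Submodule.span_mono (Set.image_mono fun x hx => ?_) hv
      simp only [Set.mem_ofPred_eq, deg2] at hx ⊢
      split_ifs <;> omega
    have hW : fil (F := F) c deg2 (2 * n) ≤ NN b l ⊔ (Pf b D' n).map ρF := by
      refine fil_le _ _ fun x hx => ?_
      by_cases hn : SupLT (l x.1) x.2
      · rw [hc1 x hn]
        exact Submodule.mem_sup_left (Submodule.subset_span ⟨x, hn, rfl⟩)
      · obtain ⟨x', m, hm, rfl⟩ := hcex x hn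
        simp only [deg2, if_neg hn, pdg, degree_add_dl] at hx
        rw [hc2 x' m hm, ← hρ]
        refine Submodule.mem_sup_right ⟨_, mem_fil _ _ ?_, rfl⟩
        simp only [pdg, D']
        omega
    obtain ⟨ν, hν, w, ⟨t', ht', rfl⟩, hw⟩ := Submodule.mem_sup.1 (hW (hspan _ hv2))
    exact ⟨ν, hν, t', ht', hw.symm⟩
  have R4 : ∀ n, ∀ v ∈ Nn b D l n, π v = 0 → ∃ t' ∈ Pf b D' n, ρ t' = v := by
    intro n v hv hπv
    have hsup : Nn b D l n ≤ NN b l ⊔ Pf b D n := by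
      rw [Nn, Submodule.span_le]
      rintro _ ⟨x, hx | hx, rfl⟩
      · exact Submodule.mem_sup_right (mem_fil _ _ hx)
      · exact Submodule.mem_sup_left (Submodule.subset_span ⟨x, hx.2, rfl⟩)
    obtain ⟨ν0, hν0, w, hw, rfl⟩ := Submodule.mem_sup.1 (hsup hv)
    obtain ⟨ν, hν, t', ht', rfl⟩ := R2 n w hw
    refine ⟨t', ht', ?_⟩
    have : ν0 + ν = 0 := by
      refine inj _ (add_mem hν0 hν) ?_
      rw [← add_assoc, map_add, hρk, add_zero] at hπv
      exact hπv
    rw [← add_assoc, this, zero_add]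
  have claim : ∀ (a : A) (j mm : Fin d), j < mm → ∀ τ ∈ Tt b D l (D a + 1) j.val,
      ∃ t' ∈ Tt b D' l' (D a + 2) mm.val, b (dl mm) • τ - ρ t' ∈ Nn b D l (D a + 2) := by
    intro a j mm hjm τ hτ
    rw [Tt] at hτ
    induction hτ using Submodule.span_induction with
    | zero => exact ⟨0, zero_mem _, by simp⟩
    | add v w _ _ hv hw =>
      obtain ⟨t1, h1, h1'⟩ := hv
      obtain ⟨t2, h2, h2'⟩ := hw
      refine ⟨t1 + t2, add_mem h1 h2, ?_⟩
      convert add_mem h1' h2' using 1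
      rw [smul_add, map_add]; abel
    | smul s v _ hv =>
      obtain ⟨t1, h1, h1'⟩ := hv
      refine ⟨s • t1, Submodule.smul_mem _ s h1, ?_⟩
      convert Submodule.smul_mem _ s h1' using 1
      rw [smul_sub, smul_comm s]
      congr 1
      exact (ρF.map_smul s t1)
    | mem v hv =>
      obtain ⟨⟨e, k⟩, hx, rfl⟩ := hv
      have hdm : (dl mm).degree = 1 := by simp [dl]
      rcases hx with hx | ⟨h1, h2, h3⟩
      · refine ⟨0, zero_mem _, ?_⟩
        have := hb.smul_Pf D (dl mm) _ _ (mem_fil (F := F) (fb b A) (pdg D) hx)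
        rw [hdm] at this
        simpa using Pf_le_Nn b D l _ this
      · simp only [pdg] at h1 h2 h3
        have h4 := hb.smul_fb D (dl mm) k e
        rw [hdm, (by omega : 1 + k.degree + D e = D a + 2)] at h4
        by_cases hm : mm.val < l e
        · refine ⟨0, zero_mem _, ?_⟩
          have h5 : fb b A ⟨e, dl mm + k⟩ ∈ Nn b D l (D a + 2) := by
            refine Submodule.subset_span ⟨_, Or.inr ⟨?_, (supLT_dl hm).add (h2.mono (by omega))⟩, rfl⟩
            simp only [pdg, map_add, hdm]; omega
          simpa using add_mem (Pf_le_Nn b D l _ h4) h5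
        · have hkm : SupLT (mm.val + 1) k := h2.mono (by have : j.val < mm.val := hjm; omega)
          refine ⟨fb b _ ⟨⟨(e, mm), by simpa using hm⟩, k⟩, ?_, ?_⟩
          · refine Submodule.subset_span ⟨_, Or.inr ⟨?_, hkm, ?_⟩, rfl⟩
            · simp only [pdg, D']; omega
            · simp only [l']; omega
          · rw [hρ]
            have h6 := hlead ⟨(e, mm), by simpa using hm⟩ k hkm
            simp only at h6
            rw [(by omega : k.degree + D e + 1 = D a + 2)] at h6
            rw [add_comm (dl mm) k] at h4
            convert sub_mem (Pf_le_Nn b D l _ h4) (Tt_le_Nn b D l _ _ h6) using 1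
            abel
  have hy' : ∀ v : Syz d l →₀ U, ((Finsupp.linearCombination U
      (fun x => (⟨r x, hr x⟩ : LinearMap.ker π)) v : LinearMap.ker π) : A →₀ U) = ρ v := by
    intro v
    have : (LinearMap.ker π).subtype ∘ₗ Finsupp.linearCombination U
      (fun x => (⟨r x, hr x⟩ : LinearMap.ker π)) = ρ := by
      refine Finsupp.lhom_ext' fun x => LinearMap.ext_ring ?_
      simp [ρ]
    exact LinearMap.congr_fun this v
  refine ⟨fun x => ⟨r x, hr x⟩, ?_, ?_, ?_⟩
  · -- injectivity on normal elements
    intro v hv h0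
    have h0' : ρ v = 0 := by rw [← hy', h0]; rfl
    rw [NN, Set.image_eq_range, Finsupp.mem_span_range_iff_exists_finsupp] at hv
    obtain ⟨q, rfl⟩ := hv
    let g : {x : Σ _ : Syz d l, (Fin d →₀ ℕ) // SupLT (x.1.1.2.val + 1) x.2} →
      (Σ _ : A, (Fin d →₀ ℕ)) := fun x => ⟨x.1.1.1.1, x.1.2 + dl x.1.1.1.2⟩
    have hg : Function.Injective g := by
      rintro ⟨⟨⟨⟨a, j⟩, hj⟩, m⟩, hm⟩ ⟨⟨⟨⟨a', j'⟩, hj'⟩, m'⟩, hm'⟩ hgg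
      simp only [g, Sigma.mk.injEq, heq_eq_eq] at hgg
      obtain ⟨rfl, h2⟩ := hgg
      obtain ⟨rfl, rfl⟩ := high_unique h2 hm hm'
      rfl
    have hli := hind.comp g hg
    have hq := linearIndependent_iff.1 hli q (by
      rw [← h0', Finsupp.linearCombination_apply, Finsupp.sum, Finsupp.sum]
      change _ = ρF _
      rw [map_sum]
      refine Finset.sum_congr rfl fun x _ => ?_
      rw [map_smul]
      congr 1
      exact (hc2 _ _ x.2).trans (hρ _ _).symm)
    rw [hq]; simp
  · rintro ⟨⟨a, j⟩, hj⟩ mm hmm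
    have hjm : j < mm := hmm
    simp only at hj
    have hjm' : j.val < mm.val := hjm
    obtain ⟨t1, ht1, h1⟩ := claim a j mm hjm _ (ht a j hj)
    let s : Syz d l := ⟨(a, mm), by simp only; omega⟩
    have h2 := hlead s (dl j) (supLT_dl (by simp only [s]; omega))
    have h3 := hb.smul_fb D (dl mm) (dl j) a
    have hd1 : (dl mm).degree = 1 := by simp [dl]
    have hd2 : (dl j).degree = 1 := by simp [dl]
    simp only [s] at h2
    rw [hd2, (by omega : 1 + D a + 1 = D a + 2)] at h2
    rw [hd1, hd2, (by omega : 1 + 1 + D a = D a + 2), add_comm (dl mm)] at h3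
    have h4 := sub_mem (sub_mem (Pf_le_Nn b D l _ h3) h1) (Tt_le_Nn b D l _ _ h2)
    have h5 : b (dl mm) • r ⟨(a, j), hj⟩ - b (dl j) • r s + ρ t1 ∈ Nn b D l (D a + 2) := by
      convert h4 using 1
      simp only [r, smul_sub, s]
      abel
    obtain ⟨t2, ht2, h6⟩ := R4 _ _ h5 (by simp [hr, hρk])
    refine ⟨fb b _ ⟨s, dl j⟩ - t1 + t2, ?_, ?_⟩
    · refine add_mem (sub_mem ?_ ht1) (Pf_le_Tt b D' l' _ _ ht2)
      refine Submodule.subset_span ⟨_, Or.inr ⟨?_, supLT_dl (by omega), ?_⟩, rfl⟩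
      · simp only [pdg, hd2, s]; omega
      · simp [s]
    · apply Subtype.ext
      rw [hy', map_add, map_sub, h6, hρ]
      simp only [Submodule.coe_smul]
      abel
  · rintro ⟨v, hv⟩
    obtain ⟨n, hn⟩ := exists_mem_fil (F := F) (fb b A) (pdg D) (fb b A).span_eq.ge v
    obtain ⟨t', -, h1⟩ := R4 n v (Pf_le_Nn b D l n hn) hv
    exact ⟨t', Subtype.ext ((hy' t').trans h1)⟩

theorem GData.pd (hb : PBWAlg b) (k : ℕ) : ∀ {A : Type u} {D l : A → ℕ} {Y : Type u}
    [AddCommGroup Y] [Module U Y] {y : A → Y}, GData b D l y → (∀ a, d ≤ l a + k) →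
    HasProjectiveDimensionLT (ModuleCat.of U Y) (k+1) := by
  induction k with
  | zero =>
    intro A D l Y _ _ y h hl
    refine pd_step U (A →₀ U) Y (Finsupp.linearCombination U y) h.surj 0 ?_
    have : Subsingleton (LinearMap.ker (Finsupp.linearCombination U y)) := by
      refine subsingleton_of_forall_eq 0 ?_
      rintro ⟨v, hv⟩
      apply Subtype.ext
      refine h.inj v ?_ hv
      have : NN b l = (⊤ : Submodule F (A →₀ U)) := by
        rw [eq_top_iff, ← (fb b A).span_eq]
        refine Submodule.span_mono ?_
        rintro _ ⟨x, rfl⟩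
        exact ⟨x, fun i _ => lt_of_lt_of_le i.2 (hl x.1), rfl⟩
      rw [this]; trivial
    rw [hasProjectiveDimensionLT_zero_iff_isZero]
    exact ModuleCat.isZero_of_subsingleton _
  | succ k ih =>
    intro A D l Y _ _ y h hl
    refine pd_step U (A →₀ U) Y (Finsupp.linearCombination U y) h.surj (k+1) ?_
    obtain ⟨y', hy'⟩ := h.step hb
    refine ih hy' ?_
    rintro ⟨⟨a, j⟩, hj⟩
    have := hl a
    simp only at hj ⊢
    omega

theorem PBWAlg.pd (hb : PBWAlg b) (X : ModuleCat.{u} U) : HasProjectiveDimensionLT X (d+1) := by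
  letI : Module F X := Module.compHom X (algebraMap F U)
  haveI : IsScalarTower F U X := ⟨fun a u x => by
    rw [Algebra.smul_def, mul_smul]; rfl⟩
  let y := Module.Basis.ofVectorSpace F X
  have hE : ∀ q : Module.Basis.ofVectorSpaceIndex F X →₀ F,
      Finsupp.linearCombination U y (q.sum fun a s => s • fb b _ ⟨a, 0⟩) =
        Finsupp.linearCombination F y q := by
    intro q
    rw [Finsupp.linearCombination_apply F, Finsupp.sum, Finsupp.sum, map_sum]
    refine Finset.sum_congr rfl fun a _ => ?_
    rw [LinearMap.map_smul_of_tower, fb_apply, Finsupp.linearCombination_single, hb.one, one_smul]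
  have hdeg0 : ∀ q : Module.Basis.ofVectorSpaceIndex F X →₀ F,
      (q.sum fun a s => s • fb b _ ⟨a, 0⟩) ∈
        Pf b (fun _ : Module.Basis.ofVectorSpaceIndex F X => 0) 1 := by
    intro q
    refine sum_mem fun a _ => Submodule.smul_mem _ _ (mem_fil _ _ ?_)
    simp [pdg]
  have hsurj : ∀ x : X, ∃ q : Module.Basis.ofVectorSpaceIndex F X →₀ F,
      Finsupp.linearCombination U y (q.sum fun a s => s • fb b _ ⟨a, 0⟩) = x := by
    intro x
    exact ⟨y.repr x, by rw [hE, y.linearCombination_repr]⟩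
  have h : GData b (fun _ => 0) (fun _ => 0) y := by
    refine ⟨?_, ?_, ?_⟩
    · intro v hv h0
      have : ∃ q : Module.Basis.ofVectorSpaceIndex F X →₀ F,
          v = q.sum fun a s => s • fb b _ ⟨a, 0⟩ := by
        have hle : NN b (fun _ : Module.Basis.ofVectorSpaceIndex F X => 0) ≤
            LinearMap.range (Finsupp.linearCombination F
              (fun a : Module.Basis.ofVectorSpaceIndex F X => fb b _ ⟨a, 0⟩)) := by
          rw [NN, Submodule.span_le]
          rintro _ ⟨⟨a, m⟩, hx, rfl⟩
          have hm : m = 0 := by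
            ext k
            by_contra hk
            exact absurd (hx k (Finsupp.mem_support_iff.2 hk)) (Nat.not_lt_zero _)
          subst hm
          exact ⟨Finsupp.single a 1, by simp⟩
        obtain ⟨q, hq⟩ := hle hv
        exact ⟨q, by rw [← hq, Finsupp.linearCombination_apply]⟩
      obtain ⟨q, rfl⟩ := this
      rw [hE] at h0
      have := linearIndependent_iff.1 y.linearIndependent q h0
      simp [this]
    · intro a j _
      obtain ⟨q, hq⟩ := hsurj (b (dl j) • y a)
      exact ⟨_, Pf_le_Tt b _ _ _ _ (hdeg0 q), hq.symm⟩
    · intro x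
      obtain ⟨q, hq⟩ := hsurj x
      exact ⟨_, hq⟩
  exact h.pd hb d (fun a => by simp)
end GB

section Lead
variable {F : Type u} [Field F] {U : Type u} [Ring U] [Algebra F U] {d : ℕ}
  {b : Module.Basis (Fin d →₀ ℕ) F U}

/-- `u` has leading monomial `m` -/
def Lead (b : Module.Basis (Fin d →₀ ℕ) F U) (u : U) (m : Fin d →₀ ℕ) : Prop :=
  u - b m ∈ fil (F := F) b (fun m => m.degree) m.degree

theorem PBWAlg.mul_mem (hb : PBWAlg b) {i j k : ℕ} {x y : U}
    (hx : x ∈ fil (F := F) b (fun m => m.degree) i) (hy : y ∈ fil (F := F) b (fun m => m.degree) j)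
    (hk : i + j ≤ k + 1) : x * y ∈ fil (F := F) b (fun m => m.degree) k := by
  have h1 : fil (F := F) b (fun m => m.degree) i ≤
      (fil (F := F) b (fun m => m.degree) k).comap (LinearMap.mulRight F y) := by
    refine fil_le _ _ fun m hm => ?_
    have h2 : fil (F := F) b (fun m => m.degree) j ≤
        (fil (F := F) b (fun m => m.degree) k).comap (LinearMap.mulLeft F (b m)) := by
      refine fil_le _ _ fun n hn => ?_
      rw [Submodule.mem_comap, LinearMap.mulLeft_apply]
      have h3 := fil_mono (F := F) b (fun m => m.degree)
        (by omega : m.degree + n.degree ≤ k) (hb.mul m n)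
      have h4 := mem_fil (F := F) b (fun m => m.degree) (n := k) (i := m + n)
        (by simp only [map_add]; omega)
      simpa using add_mem h3 h4
    exact h2 hy
  exact h1 hx

theorem Lead.mem {u : U} {m : Fin d →₀ ℕ} (h : Lead b u m) {k : ℕ} (hk : m.degree < k) :
    u ∈ fil (F := F) b (fun m => m.degree) k := by
  have h1 := fil_mono (F := F) b (fun m => m.degree) hk.le h
  have h2 := mem_fil (F := F) b (fun m => m.degree) hk
  simpa using add_mem h1 h2

theorem Lead.mul (hb : PBWAlg b) {u v : U} {m n : Fin d →₀ ℕ} (hu : Lead b u m)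
    (hv : Lead b v n) : Lead b (u * v) (m + n) := by
  have h1 := hb.mul_mem (k := m.degree + n.degree) hu (hv.mem (Nat.lt_succ_self _)) (by omega)
  have h2 := hb.mul_mem (k := m.degree + n.degree) (mem_fil b _ (Nat.lt_succ_self m.degree)) hv
    (by omega)
  have h3 := add_mem (add_mem h1 h2) (hb.mul m n)
  rw [Lead, map_add]
  convert h3 using 1
  noncomm_ring

theorem Lead.one (hb : PBWAlg b) : Lead b 1 0 := by
  rw [Lead, hb.one, sub_self]; exact zero_mem _

theorem Lead.basis (m : Fin d →₀ ℕ) : Lead b (b m) m := by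
  rw [Lead, sub_self]; exact zero_mem _

theorem Lead.pow (hb : PBWAlg b) {u : U} {m : Fin d →₀ ℕ} (hu : Lead b u m) (k : ℕ) :
    Lead b (u ^ k) (k • m) := by
  induction k with
  | zero => simpa using Lead.one hb
  | succ k ih => rw [pow_succ, succ_nsmul]; exact ih.mul hb hu

theorem Lead.aeval (hb : PBWAlg b) {u : U} {m : Fin d →₀ ℕ} (hu : Lead b u m) (hm : 1 ≤ m.degree)
    (f : Polynomial F) (hf : f.Monic) : Lead b (Polynomial.aeval u f) (f.natDegree • m) := by
  rw [Polynomial.aeval_eq_sum_range, Finset.sum_range_succ, hf.coeff_natDegree, one_smul, Lead,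
    add_sub_assoc]
  refine add_mem (sum_mem fun i hi => Submodule.smul_mem _ _ ((hu.pow hb i).mem ?_)) (hu.pow hb _)
  rw [Finset.mem_range] at hi
  simp only [map_nsmul, smul_eq_mul]
  exact Nat.mul_lt_mul_of_pos_right hi hm
end Lead

section Central
attribute [local instance] LieRing.ofAssociativeRing
variable {F : Type u} [Field F] (p : ℕ) [Fact p.Prime] [CharP F p]
    {L : Type u} [LieRing L] [LieAlgebra F L] [FiniteDimensional F L]

theorem comm_pow (x y : L) (k : ℕ) [CharP (Module.End F (UniversalEnvelopingAlgebra F L)) p] :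
    UniversalEnvelopingAlgebra.ι F x ^ p ^ k * UniversalEnvelopingAlgebra.ι F y -
      UniversalEnvelopingAlgebra.ι F y * UniversalEnvelopingAlgebra.ι F x ^ p ^ k =
    UniversalEnvelopingAlgebra.ι F ((LieAlgebra.ad F L x ^ p ^ k) y) := by
  set X := UniversalEnvelopingAlgebra.ι F x with hX
  have h1 := sub_pow_char_pow_of_commute p k (LinearMap.commute_mulLeft_right (R := F) X X)
  have h2 : ∀ n y, ((LinearMap.mulLeft F X - LinearMap.mulRight F X) ^ n)
      (UniversalEnvelopingAlgebra.ι F y) =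
      UniversalEnvelopingAlgebra.ι F ((LieAlgebra.ad F L x ^ n) y) := by
    intro n
    induction n with
    | zero => intro y; simp
    | succ n ih =>
      intro y
      rw [pow_succ, pow_succ, Module.End.mul_apply, Module.End.mul_apply, ← ih, LieAlgebra.ad_apply,
        LieHom.map_lie, LieRing.of_associative_ring_bracket]
      simp [hX]
  rw [← h2, h1]
  simp [LinearMap.pow_mulLeft, LinearMap.pow_mulRight]

theorem exists_central (x : L) (hc : CharP (Module.End F (UniversalEnvelopingAlgebra F L)) p) :
    ∃ g : Polynomial F, g.Monic ∧ 1 ≤ g.natDegree ∧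
      ∀ u, Polynomial.aeval (UniversalEnvelopingAlgebra.ι F x) g * u =
        u * Polynomial.aeval (UniversalEnvelopingAlgebra.ι F x) g := by
  have hp : p.Prime := Fact.out
  have hdep : ¬ LinearIndependent F (fun k : ℕ => LieAlgebra.ad F L x ^ p ^ k) := by
    intro h
    exact (not_finite_iff_infinite.2 (inferInstance : Infinite ℕ))
      h.finite_of_isNoetherian
  rw [linearIndependent_iff] at hdep
  push Not at hdep
  obtain ⟨c, hc0, hcne⟩ := hdep
  let g0 : Polynomial F := c.sum fun k a => Polynomial.C a * Polynomial.X ^ p ^ k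
  have hg0 : g0 ≠ 0 := by
    intro h0
    obtain ⟨k, hk⟩ := Finsupp.ne_iff.1 hcne
    apply hk
    have := congrArg (fun f => Polynomial.coeff f (p ^ k)) h0
    simp only [g0, Finsupp.sum, Polynomial.finsetSum_coeff, Polynomial.coeff_C_mul_X_pow,
      (Nat.pow_right_injective hp.two_le).eq_iff, Polynomial.coeff_zero] at this
    simpa using this
  have hev : g0.eval 0 = 0 := by
    simp only [g0, Finsupp.sum, Polynomial.eval_finsetSum]
    refine Finset.sum_eq_zero fun k _ => ?_
    simp [hp.ne_zero]
  have hcomm : ∀ u, Polynomial.aeval (UniversalEnvelopingAlgebra.ι F x) g0 * u =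
        u * Polynomial.aeval (UniversalEnvelopingAlgebra.ι F x) g0 := by
    refine uea_ind _ ?_ ?_ ?_ ?_
    · intro a; exact (Algebra.commutes a _).symm
    · intro y
      rw [← sub_eq_zero]
      simp only [g0, Finsupp.sum, map_sum, map_mul, Polynomial.aeval_C, map_pow, Polynomial.aeval_X,
        Finset.sum_mul, Finset.mul_sum, ← Finset.sum_sub_distrib]
      rw [Finsupp.linearCombination_apply] at hc0
      have := congrArg (fun T => UniversalEnvelopingAlgebra.ι F (T y)) hc0
      simp only [Finsupp.sum, LinearMap.sum_apply, map_sum, LinearMap.smul_apply, map_smul,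
        LinearMap.zero_apply, map_zero] at this
      rw [← this]
      refine Finset.sum_congr rfl fun k _ => ?_
      rw [← comm_pow p x y k, smul_sub, ← Algebra.smul_def, smul_mul_assoc, mul_smul_comm]
    · intro a b ha hb; rw [mul_add, add_mul, ha, hb]
    · intro a b ha hb; rw [← mul_assoc, ha, mul_assoc, hb, mul_assoc]
  have hlc : g0.leadingCoeff ≠ 0 := Polynomial.leadingCoeff_ne_zero.2 hg0
  have hmon : (g0 * Polynomial.C g0.leadingCoeff⁻¹).Monic :=
    Polynomial.monic_mul_leadingCoeff_inv hg0
  refine ⟨_, hmon, ?_, ?_⟩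
  · by_contra h
    have h1 := hmon.natDegree_eq_zero.1 (by omega)
    have := congrArg (Polynomial.eval 0) h1
    simp [hev] at this
  · intro u
    rw [map_mul, Polynomial.aeval_C, ← Algebra.commutes, ← Algebra.smul_def, smul_mul_assoc, hcomm,
      mul_smul_comm]
end Central

section Triang
variable {F : Type u} [Field F] {U : Type u} [Ring U] [Algebra F U] {d : ℕ}
  {b : Module.Basis (Fin d →₀ ℕ) F U}

theorem exists_phi (w : Fin d → U) (hw : ∀ i u, w i * u = u * w i) :
    ∃ φ : MvPolynomial (Fin d) F →ₐ[F] U, (∀ i, φ (MvPolynomial.X i) = w i) ∧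
      ∀ P u, φ P * u = u * φ P := by
  let w' : Fin d → Subalgebra.center F U := fun i =>
    ⟨w i, Subalgebra.mem_center_iff.2 fun u => (hw i u).symm⟩
  refine ⟨(Subalgebra.center F U).val.comp (MvPolynomial.aeval w'), fun i => ?_, fun P u => ?_⟩
  · simp [w']
  · exact (Subalgebra.mem_center_iff.1 (MvPolynomial.aeval w' P).2 u).symm

theorem exists_tri (hb : PBWAlg b) (w : Fin d → U) (q : Fin d → ℕ) (hq : ∀ i, 1 ≤ q i)
    (hl : ∀ i, Lead b (w i) (q i • dl i)) (φ : MvPolynomial (Fin d) F →ₐ[F] U)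
    (hφ : ∀ i, φ (MvPolynomial.X i) = w i) :
    ∃ c : Module.Basis (Fin d →₀ ℕ) F U, (∀ i m, w i * c m = c (m + q i • dl i)) ∧
      ∀ m, ∃ P r, (∀ i, r i < q i) ∧ c m = φ P * b r := by
  classical
  let mq : (Fin d →₀ ℕ) → (Fin d →₀ ℕ) := fun m =>
    Finsupp.equivFunOnFinite.symm (fun i => m i * q i)
  let dv : (Fin d →₀ ℕ) → (Fin d →₀ ℕ) := fun m =>
    Finsupp.equivFunOnFinite.symm (fun i => m i / q i)
  let md : (Fin d →₀ ℕ) → (Fin d →₀ ℕ) := fun m =>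
    Finsupp.equivFunOnFinite.symm (fun i => m i % q i)
  have hW : ∀ m, Lead b (φ (MvPolynomial.monomial m 1)) (mq m) := by
    intro m
    induction m using Finsupp.induction_linear with
    | zero =>
      have : mq 0 = 0 := by ext i; simp [mq]
      rw [this]
      simpa using Lead.one hb
    | add m n hm hn =>
      have : mq (m + n) = mq m + mq n := by ext i; simp [mq, add_mul]
      rw [this]
      have h2 := hm.mul hb hn
      rwa [← map_mul, MvPolynomial.monomial_mul, one_mul] at h2
    | single i k =>
      have : mq (Finsupp.single i k) = k • (q i • dl i) := by
        ext j
        by_cases h : i = j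
        · subst h; simp [mq, dl]
        · simp [mq, dl, h]
      rw [this, ← MvPolynomial.X_pow_eq_monomial (R := F), map_pow, hφ]
      exact (hl i).pow hb k
  let c : (Fin d →₀ ℕ) → U := fun m => φ (MvPolynomial.monomial (dv m) 1) * b (md m)
  have hc : ∀ m, Lead b (c m) m := by
    intro m
    have h1 := (hW (dv m)).mul hb (Lead.basis (md m))
    have : mq (dv m) + md m = m := by
      ext i
      simp [mq, dv, md, Nat.div_add_mod']
    rwa [this] at h1
  have hind : LinearIndependent F c := tri_indep b (fun m => m.degree) c hc
  have hsp : ⊤ ≤ Submodule.span F (Set.range c) := by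
    intro u _
    obtain ⟨n, hn⟩ := exists_mem_fil (F := F) b (fun m => m.degree) b.span_eq.ge u
    exact Submodule.span_mono (Set.image_subset_range _ _)
      (tri_span (F := F) b (fun m => m.degree) c hc n hn)
  refine ⟨Module.Basis.mk hind hsp, ?_, ?_⟩
  · intro i m
    rw [Module.Basis.mk_apply, Module.Basis.mk_apply]
    have h1 : dv (m + q i • dl i) = dl i + dv m := by
      ext j
      by_cases h : i = j
      · subst h
        simp only [dv, dl, Finsupp.coe_add, Finsupp.coe_smul, Pi.add_apply, Pi.smul_apply,
          Finsupp.single_eq_same, smul_eq_mul, mul_one, Finsupp.equivFunOnFinite_symm_apply_apply]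
        rw [Nat.add_div_right _ (hq i)]; omega
      · simp [dv, dl, h]
    have h2 : md (m + q i • dl i) = md m := by
      ext j
      by_cases h : i = j
      · subst h; simp [md, dl]
      · simp [md, dl, h]
    simp only [c]
    rw [h1, h2, ← hφ, ← mul_assoc, ← map_mul, MvPolynomial.X, MvPolynomial.monomial_mul, one_mul]
    rfl
  · intro m
    refine ⟨_, md m, fun i => ?_, Module.Basis.mk_apply _ _ _⟩
    simp only [md, Finsupp.equivFunOnFinite_symm_apply_apply]
    exact Nat.mod_lt _ (hq i)

theorem exists_maximal (hb : PBWAlg b) (w : Fin d → U) (hw : ∀ i u, w i * u = u * w i)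
    (q : Fin d → ℕ) (hq : ∀ i, 1 ≤ q i)
    (hl : ∀ i, Lead b (w i) (q i • dl i)) (M : Type u) [AddCommGroup M] [Module U M]
    [Module.Finite U M] [Nontrivial M] :
    ∃ (f : Fin d → Polynomial F) (N : AddSubgroup M), N ≠ ⊤ ∧
      ∀ i, (f i).Monic ∧ 1 ≤ (f i).natDegree ∧ ∀ x : M, Polynomial.aeval (w i) (f i) • x ∈ N := by
  obtain ⟨φ, hφ, hφc⟩ := exists_phi (F := F) w hw
  obtain ⟨c, -, hc⟩ := exists_tri hb w q hq hl φ hφ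
  let P := MvPolynomial (Fin d) F
  let : Algebra P U := φ.toRingHom.toAlgebra' hφc
  let : Module P M := Module.compHom M φ.toRingHom
  have hsm : ∀ (a : P) (x : M), a • x = φ a • x := fun _ _ => rfl
  have hsU : ∀ (a : P) (x : U), a • x = φ a * x := fun _ _ => rfl
  have : IsScalarTower P U M := ⟨fun a u x => by rw [hsU, mul_smul, hsm]⟩
  have : IsScalarTower F P U := ⟨fun a r x => by rw [hsU, hsU, map_smul, smul_mul_assoc]⟩
  have hfin : Module.Finite P U := by
    refine Module.finite_def.2 ?_
    have : Submodule.span P (Set.range fun r : (∀ i, Fin (q i)) =>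
        b (Finsupp.equivFunOnFinite.symm fun i => (r i : ℕ))) = ⊤ := by
      rw [eq_top_iff]
      intro u _
      have hu : u ∈ Submodule.span F (Set.range c) := by rw [c.span_eq]; trivial
      refine (Submodule.span_le (p := (Submodule.span P (Set.range fun r : (∀ i, Fin (q i)) =>
        b (Finsupp.equivFunOnFinite.symm fun i => (r i : ℕ)))).restrictScalars F)).2 ?_ hu
      rintro _ ⟨m, rfl⟩
      obtain ⟨a, r, hr, h⟩ := hc m
      rw [h, ← hsU]
      refine Submodule.smul_mem _ _ (Submodule.subset_span ?_)
      refine ⟨fun i => ⟨r i, hr i⟩, ?_⟩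
      dsimp only
      congr 1
      ext i; simp
    rw [← this]
    exact Submodule.fg_span (Set.finite_range _)
  have : Module.Finite P M := Module.Finite.trans U M
  obtain ⟨N, hN⟩ := (eq_top_or_exists_le_coatom (⊥ : Submodule P M)).resolve_left bot_ne_top
  have hsimp : IsSimpleModule P (M ⧸ N) := isSimpleModule_iff_isCoatom.2 hN.1
  have hmax : (Module.annihilator P (M ⧸ N)).IsMaximal := IsSimpleModule.annihilator_isMaximal
  let : Field (P ⧸ Module.annihilator P (M ⧸ N)) := Ideal.Quotient.field _
  have hK : Module.Finite F (P ⧸ Module.annihilator P (M ⧸ N)) :=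
    finite_of_finite_type_of_isJacobsonRing _ _
  have hintg : ∀ i : Fin d, IsIntegral F (Ideal.Quotient.mkₐ F (Module.annihilator P (M ⧸ N))
    (MvPolynomial.X i)) := fun i => Algebra.IsIntegral.isIntegral _
  choose f hf hf0 using hintg
  refine ⟨f, N.toAddSubgroup, ?_, ?_⟩
  · intro h
    apply hN.1.1
    rw [eq_top_iff]
    intro x _
    have : x ∈ N.toAddSubgroup := by rw [h]; trivial
    exact this
  · intro i
    have hf1 := hf0 i
    rw [← Polynomial.aeval_def, Polynomial.aeval_algHom_apply] at hf1
    refine ⟨hf i, ?_, ?_⟩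
    · by_contra h
      rw [(hf i).natDegree_eq_zero.1 (by omega)] at hf1
      simp at hf1
    · intro x
      have hm : Polynomial.aeval (MvPolynomial.X i) (f i) ∈ Module.annihilator P (M ⧸ N) :=
        Ideal.Quotient.eq_zero_iff_mem.1 hf1
      rw [Module.mem_annihilator] at hm
      have h2 := hm (Submodule.Quotient.mk x)
      rw [← Submodule.Quotient.mk_smul, Submodule.Quotient.mk_eq_zero, hsm,
        ← Polynomial.aeval_algHom_apply, hφ] at h2
      exact h2

/-- the left ideals of the Koszul tower -/
def Jk (w : Fin d → U) (k : ℕ) : Submodule U U := Submodule.span U (w '' {i | i.val < k})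

theorem ext_tower (hb : PBWAlg b) (w : Fin d → U) (hw : ∀ i u, w i * u = u * w i)
    (q : Fin d → ℕ) (hq : ∀ i, 1 ≤ q i)
    (hl : ∀ i, Lead b (w i) (q i • dl i)) (S : Type u) [AddCommGroup S] [Module U S]
    [Nontrivial S] (hS : ∀ i (s : S), w i • s = 0) (k : ℕ) (hk : k ≤ d) :
    Nontrivial (Abelian.Ext.{u} (ModuleCat.of U (U ⧸ Jk w k)) (ModuleCat.of U S) k) := by
  obtain ⟨φ, hφ, hφc⟩ := exists_phi (F := F) w hw
  obtain ⟨c, hc, -⟩ := exists_tri hb w q hq hl φ hφ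
  have hJ : ∀ k u, u ∈ Jk w k ↔
      u ∈ Submodule.span F (c '' {m | ∃ i : Fin d, i.val < k ∧ q i ≤ m i}) := by
    intro k u
    constructor
    · intro hu
      have : ∀ r, r * u ∈ Submodule.span F (c '' {m | ∃ i : Fin d, i.val < k ∧ q i ≤ m i}) := by
        rw [Jk] at hu
        induction hu using Submodule.span_induction with
        | zero => intro r; simp
        | add x y _ _ hx hy => intro r; rw [mul_add]; exact add_mem (hx r) (hy r)
        | smul a x _ hx => intro r; rw [smul_eq_mul, ← mul_assoc]; exact hx _
        | mem x hx =>
          obtain ⟨i, hi, rfl⟩ := hx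
          intro r
          rw [← hw]
          have hr : r ∈ Submodule.span F (Set.range c) := by rw [c.span_eq]; trivial
          refine (Submodule.span_le (p := (Submodule.span F
            (c '' {m | ∃ i : Fin d, i.val < k ∧ q i ≤ m i})).comap
              (LinearMap.mulLeft F (w i)))).2 ?_ hr
          rintro _ ⟨m, rfl⟩
          rw [SetLike.mem_coe, Submodule.mem_comap, LinearMap.mulLeft_apply, hc]
          exact Submodule.subset_span (Set.mem_image_of_mem c ⟨i, hi, by simp [dl]⟩)
      simpa using this 1
    · intro hu
      refine (Submodule.span_le (p := (Jk w k).restrictScalars F)).2 ?_ hu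
      rintro _ ⟨m, ⟨i, hi, hm⟩, rfl⟩
      have : m = (m - q i • dl i) + q i • dl i := by
        rw [tsub_add_cancel_of_le]
        rw [dl, Finsupp.smul_single, smul_eq_mul, mul_one, Finsupp.single_le_iff]
        exact hm
      rw [this, ← hc, hw]
      exact Submodule.smul_mem _ _ (Submodule.subset_span (Set.mem_image_of_mem w hi))
  induction k with
  | zero =>
    have h0 : Jk w 0 = ⊥ := by simp [Jk]
    obtain ⟨s, hs⟩ := exists_ne (0 : S)
    have : Nontrivial (ModuleCat.of U (U ⧸ Jk w 0) ⟶ ModuleCat.of U S) := by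
      refine ⟨⟨ModuleCat.ofHom ((Jk w 0).liftQ (LinearMap.toSpanSingleton U S s)
        (by rw [h0]; exact bot_le)), 0, fun h => hs ?_⟩⟩
      have := congrArg (fun f => f.hom (Submodule.Quotient.mk (1:U))) h
      simpa using this
    exact Abelian.Ext.addEquiv₀.toEquiv.nontrivial
  | succ k ih =>
    let κ : Fin d := ⟨k, hk⟩
    have hle : Jk w k ≤ Jk w (k+1) :=
      Submodule.span_mono (Set.image_mono fun i (hi : i.val < k) => Nat.lt_succ_of_lt hi)
    refine ext_ne_step U (w κ) (hw κ) (ModuleCat.of U S) (hS κ) (U ⧸ Jk w k) (U ⧸ Jk w (k+1))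
      ?_ (Submodule.factor hle) (Submodule.factor_surjective hle) ?_ k (ih (by omega))
    · intro x hx
      obtain ⟨u, rfl⟩ := Submodule.Quotient.mk_surjective _ x
      rw [← Submodule.Quotient.mk_smul, Submodule.Quotient.mk_eq_zero, smul_eq_mul, hJ,
        Module.Basis.mem_span_image] at hx
      rw [Submodule.Quotient.mk_eq_zero, hJ, Module.Basis.mem_span_image]
      intro m hm
      have hrep : ∀ u, c.repr (w κ * u) (m + q κ • dl κ) = c.repr u m := by
        intro u
        have : (Finsupp.lapply (m + q κ • dl κ) ∘ₗ c.repr.toLinearMap) ∘ₗ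
            LinearMap.mulLeft F (w κ) = Finsupp.lapply m ∘ₗ c.repr.toLinearMap := by
          classical
          refine c.ext fun n => ?_
          simp [hc, Finsupp.single_apply]
        exact LinearMap.congr_fun this u
      rw [Finset.mem_coe, Finsupp.mem_support_iff, ← hrep] at hm
      obtain ⟨i, hi, hqi⟩ := hx (Finset.mem_coe.2 (Finsupp.mem_support_iff.2 hm))
      refine ⟨i, hi, ?_⟩
      have : κ ≠ i := by rintro rfl; simp [κ] at hi
      simpa [dl, this] using hqi
    · intro x
      obtain ⟨u, rfl⟩ := Submodule.Quotient.mk_surjective _ x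
      rw [← Submodule.mkQ_apply, ← LinearMap.comp_apply, Submodule.factor_comp_mk,
        Submodule.mkQ_apply, Submodule.Quotient.mk_eq_zero]
      have hsup : Jk w (k+1) = Jk w k ⊔ Submodule.span U {w κ} := by
        rw [Jk, Jk, ← Submodule.span_union]
        congr 1
        ext v
        constructor
        · rintro ⟨i, hi, rfl⟩
          rcases Nat.lt_succ_iff_lt_or_eq.1 hi with h | h
          · exact Or.inl ⟨i, h, rfl⟩
          · have : i = κ := Fin.ext h
            exact Or.inr (by rw [this]; rfl)
        · rintro (⟨i, hi, rfl⟩ | h)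
          · exact ⟨i, Nat.lt_succ_of_lt hi, rfl⟩
          · exact ⟨κ, Nat.lt_succ_self k, h.symm⟩
      rw [hsup, Submodule.mem_sup]
      constructor
      · rintro ⟨y, hy, z, hz, rfl⟩
        obtain ⟨a, rfl⟩ := Submodule.mem_span_singleton.1 hz
        refine ⟨Submodule.Quotient.mk a, ?_⟩
        rw [← Submodule.Quotient.mk_smul, Submodule.mkQ_apply, eq_comm, Submodule.Quotient.eq,
          smul_eq_mul, smul_eq_mul, hw]
        simpa using hy
      · rintro ⟨y, hy⟩
        obtain ⟨a, rfl⟩ := Submodule.Quotient.mk_surjective _ y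
        rw [← Submodule.Quotient.mk_smul, Submodule.mkQ_apply, eq_comm, Submodule.Quotient.eq] at hy
        refine ⟨_, hy, a * w κ, Submodule.mem_span_singleton.2 ⟨a, rfl⟩, ?_⟩
        rw [smul_eq_mul, hw]
        simp
end Triang

/-- The key non-vanishing result. -/
theorem ext_nontrivial (F : Type u) [Field F] (p : ℕ) [Fact p.Prime] [CharP F p]
    (L : Type u) [LieRing L] [LieAlgebra F L] [FiniteDimensional F L]
    (M : Type u) [AddCommGroup M] [Module (UniversalEnvelopingAlgebra F L) M]
    [Module.Finite (UniversalEnvelopingAlgebra F L) M] [Nontrivial M]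
    (b : Module.Basis (Fin (Module.finrank F L) →₀ ℕ) F (UniversalEnvelopingAlgebra F L))
    (hb : PBWAlg b) (e : Module.Basis (Fin (Module.finrank F L)) F L)
    (hbe : ∀ i, b (dl i) = UniversalEnvelopingAlgebra.ι F (e i)) :
    ∃ X : ModuleCat.{u} (UniversalEnvelopingAlgebra F L),
      Nontrivial (Abelian.Ext.{u} X (ModuleCat.of (UniversalEnvelopingAlgebra F L) M)
        (Module.finrank F L)) := by
  have hnt : Nontrivial (UniversalEnvelopingAlgebra F L) := ⟨⟨b 0, 0, b.ne_zero 0⟩⟩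
  have hch : CharP (Module.End F (UniversalEnvelopingAlgebra F L)) p :=
    charP_of_injective_algebraMap (algebraMap F _).injective p
  have hcen := fun i => exists_central p (e i) hch
  choose g hg hg1 hgc using hcen
  let z := fun i => Polynomial.aeval (UniversalEnvelopingAlgebra.ι F (e i)) (g i)
  have hdd : ∀ i : Fin (Module.finrank F L), (dl i).degree = 1 := fun i => by simp [dl]
  have hz : ∀ i, Lead b (z i) ((g i).natDegree • dl i) := by
    intro i
    have h1 : Lead b (UniversalEnvelopingAlgebra.ι F (e i)) (dl i) := by
      rw [← hbe]; exact Lead.basis _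
    exact h1.aeval hb (hdd i).ge _ (hg i)
  obtain ⟨f, N, hN, hf⟩ := exists_maximal hb z hgc _ hg1 hz M
  let w := fun i => Polynomial.aeval (z i) (f i)
  have hwl : ∀ i, Lead b (w i) (((f i).natDegree * (g i).natDegree) • dl i) := by
    intro i
    rw [mul_smul]
    refine (hz i).aeval hb ?_ _ (hf i).1
    rw [map_nsmul, hdd, smul_eq_mul, mul_one]
    exact hg1 i
  have hwc : ∀ i u, w i * u = u * w i := by
    intro i u
    have hc : Commute (z i) u := hgc i u
    simp only [w]
    rw [Polynomial.aeval_eq_sum_range, Finset.sum_mul, Finset.mul_sum]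
    refine Finset.sum_congr rfl fun k _ => ?_
    rw [smul_mul_assoc, mul_smul_comm, (hc.pow_left k).eq]
  let I : Submodule (UniversalEnvelopingAlgebra F L) M :=
    Submodule.span _ {x | ∃ i y, w i • y = x}
  have hI : ∀ x ∈ I, ∀ u : UniversalEnvelopingAlgebra F L, u • x ∈ N := by
    intro x hx
    induction hx using Submodule.span_induction with
    | zero => intro u; rw [smul_zero]; exact zero_mem _
    | add x y _ _ hx hy => intro u; rw [smul_add]; exact add_mem (hx u) (hy u)
    | smul a x _ hx => intro u; rw [smul_smul]; exact hx _
    | mem x hx =>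
      obtain ⟨i, y, rfl⟩ := hx
      intro u
      rw [smul_smul, ← hwc, mul_smul]
      exact (hf i).2.2 _
  have hIt : I ≠ ⊤ := by
    intro h
    apply hN
    rw [eq_top_iff]
    intro x _
    simpa using hI x (by rw [h]; trivial) 1
  have : Nontrivial (M ⧸ I) := Submodule.Quotient.nontrivial_iff.2 hIt
  have hE := ext_tower hb w hwc _ (fun i => Nat.mul_pos (hf i).2.1 (hg1 i)) hwl (M ⧸ I) (by
    intro i s
    obtain ⟨x, rfl⟩ := Submodule.Quotient.mk_surjective _ s
    rw [← Submodule.Quotient.mk_smul, Submodule.Quotient.mk_eq_zero]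
    exact Submodule.subset_span ⟨i, x, rfl⟩) _ le_rfl
  have := hb.pd (ModuleCat.of (UniversalEnvelopingAlgebra F L)
    (UniversalEnvelopingAlgebra F L ⧸ Jk w (Module.finrank F L)))
  exact ⟨_, ext_quot_ne _ _ M (M ⧸ I) I.mkQ I.mkQ_surjective _ hE⟩

/-- Over a field of prime characteristic, every nonzero finitely generated
module over the universal enveloping algebra of a nonzero finite-dimensional Lie algebra
`𝔞` has injective dimension exactly `dim_F 𝔞`; in particular it is not injective. -/
theorem injective_dimension_of_noetherian_module
    (F : Type u) [Field F] (p : ℕ) [Fact p.Prime] [CharP F p]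
    (L : Type u) [LieRing L] [LieAlgebra F L] [FiniteDimensional F L] [Nontrivial L]
    (M : Type u) [AddCommGroup M] [Module (UniversalEnvelopingAlgebra F L) M]
    [Module.Finite (UniversalEnvelopingAlgebra F L) M] [Nontrivial M] :
    InjDimEq F (UniversalEnvelopingAlgebra F L)
      (ModuleCat.of (UniversalEnvelopingAlgebra F L) M) (Module.finrank F L) ∧
    ¬ Module.Injective (UniversalEnvelopingAlgebra F L) M := by
  let e := Module.finBasis F L
  have hb : PBWAlg (pbw e) := ⟨by rw [pbw_apply, mono_zero], pbw_mul e⟩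
  obtain ⟨X, hX⟩ := ext_nontrivial F p L M (pbw e) hb e (pbw_dl e)
  have hpos : 0 < Module.finrank F L := Module.finrank_pos
  obtain ⟨k, hk⟩ : ∃ k, Module.finrank F L = k + 1 := ⟨Module.finrank F L - 1, by omega⟩
  refine ⟨⟨?_, X, ?_⟩, ?_⟩
  · intro Y n hn
    obtain ⟨n, rfl⟩ : ∃ m, n = m + 1 := ⟨n - 1, by omega⟩
    rw [bridge]
    have := hb.pd Y
    exact subsingleton_of_forall_eq 0 fun x =>
      Abelian.Ext.eq_zero_of_hasProjectiveDimensionLT x (Module.finrank F L + 1) hn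
  · rw [hk] at hX ⊢
    rw [← not_subsingleton_iff_nontrivial, bridge, not_subsingleton_iff_nontrivial]
    exact hX
  · intro hinj
    have : Injective (ModuleCat.of (UniversalEnvelopingAlgebra F L) M) :=
      (Module.injective_iff_injective_object _ _).1 hinj
    rw [hk] at hX
    obtain ⟨x, hx⟩ := exists_ne (0 : Abelian.Ext.{u} X
      (ModuleCat.of (UniversalEnvelopingAlgebra F L) M) (k + 1))
    exact hx (Abelian.Ext.eq_zero_of_injective x)
end
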